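/- arXiv:1307.3208 — 3 statements merged into one kernel-verified Lean document; each statement's English description precedes it below -/
import Mathlib

section
/- Let k ≥ 1 be an integer and let P ⊂ ℝ^n be a full-dimensional smooth lattice polytope. Then the following are equivalent: (i) every edge of P has lattice length at least k, and there exists a nonzero polynomial f ∈ ℝ[x_1, …, x_n] of total degree at most k+1 vanishing at every point of P ∩ ℤ^n; (ii) every edge of P has lattice length at least k, and P is lattice-isomorphic to a Cayley polytope [P_0*P_1]^k. -/
open Set

/-- The real point corresponding to an integer lattice point. -/
def toR {n : ℕ} (v : Fin n → ℤ) : Fin n → ℝ := fun i => (v i : ℝ)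

/-- `P` is a lattice polytope: the convex hull of a finite set of integer points. -/
def IsLatticePolytope {n : ℕ} (P : Set (Fin n → ℝ)) : Prop :=
  ∃ S : Finset (Fin n → ℤ), P = convexHull ℝ (toR '' (S : Set (Fin n → ℤ)))

/-- `P` is full-dimensional: its affine span is everything. -/
def IsFullDim {n : ℕ} (P : Set (Fin n → ℝ)) : Prop :=
  affineSpan ℝ P = ⊤

/-- A vertex of `P` is an extreme point of `P`. -/
def IsVertex {n : ℕ} (P : Set (Fin n → ℝ)) (v : Fin n → ℝ) : Prop :=
  v ∈ Set.extremePoints ℝ P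

/-- The segment from `a` to `b` (distinct integer points) is an edge of `P`,
i.e. an exposed face of `P` which is a segment. -/
def IsEdge {n : ℕ} (P : Set (Fin n → ℝ)) (a b : Fin n → ℤ) : Prop :=
  a ≠ b ∧ IsExposed ℝ P (segment ℝ (toR a) (toR b))

/-- The lattice length of an integer vector: the gcd of its entries. -/
def latticeLength {n : ℕ} (v : Fin n → ℤ) : ℕ :=
  Finset.univ.gcd fun i => (v i).natAbs

/-- The primitive integer vector in the direction of `v`. -/
def primVec {n : ℕ} (v : Fin n → ℤ) : Fin n → ℤ :=
  fun i => v i / (latticeLength v : ℤ)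

/-- `P` is smooth at the integer vertex `v`: there are exactly `n` edges through `v`
and the primitive directions of these edges form a `ℤ`-basis of `ℤⁿ`. -/
def SmoothAtVertex {n : ℕ} (P : Set (Fin n → ℝ)) (v : Fin n → ℤ) : Prop :=
  ∃ b : Fin n → (Fin n → ℤ),
    Function.Injective b ∧
    (∀ i, IsEdge P v (b i)) ∧
    (∀ c : Fin n → ℤ, IsEdge P v c →
      ∃ i, segment ℝ (toR v) (toR c) = segment ℝ (toR v) (toR (b i))) ∧
    IsUnit (Matrix.det (Matrix.of fun i => primVec (b i - v)))

/-- `P` is a full-dimensional smooth lattice polytope. -/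
def IsSmoothPolytope {n : ℕ} (P : Set (Fin n → ℝ)) : Prop :=
  IsLatticePolytope P ∧ IsFullDim P ∧
    ∀ v : Fin n → ℤ, IsVertex P (toR v) → SmoothAtVertex P v

/-- Every edge of `P` has lattice length at least `k`. -/
def EdgesAtLeast {n : ℕ} (P : Set (Fin n → ℝ)) (k : ℕ) : Prop :=
  ∀ a b : Fin n → ℤ, IsEdge P a b → k ≤ latticeLength (b - a)

/-- `P` is a Cayley polytope of order `k` with altitude in direction `eᵢ`:
`P ⊆ {x : 0 ≤ xᵢ ≤ k}` and every vertex of `P` has `i`-th coordinate `0` or `k`. -/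
def IsCayley {n : ℕ} (P : Set (Fin n → ℝ)) (k : ℕ) (i : Fin n) : Prop :=
  (∀ x ∈ P, 0 ≤ x i ∧ x i ≤ (k : ℝ)) ∧
  (∀ v : Fin n → ℝ, IsVertex P v → v i = 0 ∨ v i = (k : ℝ))

/-- `P` is canonically positioned: `0` is a vertex and for each `i` there is an
edge of `P` contained in the nonnegative `xᵢ`-coordinate axis. -/
def CanonicallyPositioned {n : ℕ} (P : Set (Fin n → ℝ)) : Prop :=
  IsVertex P 0 ∧
  ∀ i : Fin n, ∃ a b : Fin n → ℤ, IsEdge P a b ∧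
    segment ℝ (toR a) (toR b) ⊆ {x | 0 ≤ x i ∧ ∀ j, j ≠ i → x j = 0}

/-- `F` is a facet of `P`: an exposed face of dimension `n - 1`. -/
def IsFacet {n : ℕ} (P F : Set (Fin n → ℝ)) : Prop :=
  IsExposed ℝ P F ∧ Module.finrank ℝ (affineSpan ℝ F).direction = n - 1

/-- The lattice width of `Q`: the minimum over nonzero integer functionals `φ` of
`max_{x ∈ Q} ⟨φ, x⟩ - min_{x ∈ Q} ⟨φ, x⟩`. -/
noncomputable def latticeWidth {n : ℕ} (Q : Set (Fin n → ℝ)) : ℝ :=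
  ⨅ φ : {φ : Fin n → ℤ // φ ≠ 0},
    (sSup ((fun x => ∑ i, (φ.1 i : ℝ) * x i) '' Q) -
      sInf ((fun x => ∑ i, (φ.1 i : ℝ) * x i) '' Q))

/-- The falling-factorial polynomial `∏ᵢ xᵢ (xᵢ - 1) ⋯ (xᵢ - aᵢ + 1)`. -/
noncomputable def fallingPoly {n : ℕ} (a : Fin n → ℕ) : MvPolynomial (Fin n) ℝ :=
  ∏ i, ∏ t ∈ Finset.range (a i), (MvPolynomial.X i - MvPolynomial.C (t : ℝ))

lemma X_mul_fallingPoly {n : ℕ} (a : Fin n → ℕ) (i : Fin n) :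
    MvPolynomial.X i * fallingPoly a =
      fallingPoly (a + Pi.single i 1) + (a i : ℝ) • fallingPoly a := by
  have h : fallingPoly (a + Pi.single i 1) =
      fallingPoly a * (MvPolynomial.X i - MvPolynomial.C (a i : ℝ)) := by
    unfold fallingPoly
    rw [← Finset.mul_prod_erase _ _ (Finset.mem_univ i),
      ← Finset.mul_prod_erase Finset.univ
        (fun j => ∏ t ∈ Finset.range (a j), (MvPolynomial.X j - MvPolynomial.C (t : ℝ)))
        (Finset.mem_univ i)]
    have : ∀ j ∈ Finset.univ.erase i, (a + Pi.single i 1 : Fin n → ℕ) j = a j := by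
      intro j hj
      simp [Finset.ne_of_mem_erase hj]
    rw [Finset.prod_congr (s₁ := Finset.univ.erase i) rfl fun j hj => by rw [this j hj]]
    simp only [Pi.add_apply, Pi.single_eq_same, Finset.prod_range_succ]
    ring
  rw [h, MvPolynomial.smul_eq_C_mul]
  ring

lemma fallingPoly_eval {n : ℕ} (a b : Fin n → ℕ) :
    MvPolynomial.eval (fun i => (b i : ℝ)) (fallingPoly a) =
      ∏ i, ((b i).descFactorial (a i) : ℝ) := by
  simp only [fallingPoly, map_prod, map_sub, MvPolynomial.eval_X, MvPolynomial.eval_C]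
  refine Finset.prod_congr rfl fun i _ => ?_
  induction a i with
  | zero => simp
  | succ t ih =>
    rw [Finset.prod_range_succ, ih, Nat.descFactorial_succ, Nat.cast_mul]
    rcases le_or_gt t (b i) with h | h
    · rw [Nat.cast_sub h]; ring
    · simp [Nat.descFactorial_of_lt h]

/-- The span of the falling-factorial polynomials of degree at most `d`. -/
noncomputable def fallingSpan (n d : ℕ) : Submodule ℝ (MvPolynomial (Fin n) ℝ) :=
  Submodule.span ℝ (fallingPoly '' {a : Fin n → ℕ | ∑ i, a i ≤ d})

lemma X_mul_mem_fallingSpan {n d : ℕ} (i : Fin n) {p : MvPolynomial (Fin n) ℝ}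
    (hp : p ∈ fallingSpan n d) : MvPolynomial.X i * p ∈ fallingSpan n (d + 1) := by
  induction hp using Submodule.span_induction with
  | mem x hx =>
    obtain ⟨a, ha, rfl⟩ := hx
    rw [X_mul_fallingPoly]
    rw [Set.mem_ofPred_eq] at ha
    refine add_mem (Submodule.subset_span ⟨_, ?_, rfl⟩)
      (Submodule.smul_mem _ _ (Submodule.subset_span ⟨_, ?_, rfl⟩))
    · simpa [Finset.sum_add_distrib] using ha
    · exact ha.trans (Nat.le_succ d)
  | zero => simp
  | add x y _ _ hx hy => rw [mul_add]; exact add_mem hx hy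
  | smul r x _ hx => rw [mul_smul_comm]; exact Submodule.smul_mem _ _ hx

lemma fallingSpan_mono {n : ℕ} : Monotone (fallingSpan n) := fun _ _ h =>
  Submodule.span_mono (Set.image_mono fun _ ha => le_trans ha h)

lemma monomial_mem_fallingSpan {n : ℕ} (s : Fin n →₀ ℕ) (r : ℝ) :
    MvPolynomial.monomial s r ∈ fallingSpan n s.degree := by
  induction h : s.degree generalizing s with
  | zero =>
    have : s = 0 := (Finsupp.degree_eq_zero_iff s).1 h
    subst this
    have h1 : MvPolynomial.monomial (0 : Fin n →₀ ℕ) r = r • fallingPoly 0 := by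
      simp [fallingPoly, MvPolynomial.smul_eq_C_mul]
    rw [h1]
    exact Submodule.smul_mem _ _ (Submodule.subset_span ⟨0, by simp, rfl⟩)
  | succ d ih =>
    obtain ⟨i, hi⟩ : ∃ i, s i ≠ 0 := by
      by_contra! hc
      have : s = 0 := Finsupp.ext hc
      simp [this] at h
    have hs : s = Finsupp.single i 1 + (s - Finsupp.single i 1) := by
      rw [add_tsub_cancel_of_le]
      simpa using Nat.one_le_iff_ne_zero.2 hi
    have hd : (s - Finsupp.single i 1).degree = d := by
      have := congrArg Finsupp.degree hs
      rw [map_add, Finsupp.degree_single] at this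
      omega
    rw [hs, ← one_mul r, ← MvPolynomial.monomial_mul]
    exact X_mul_mem_fallingSpan i (ih _ hd)

lemma mem_fallingSpan {n d : ℕ} {g : MvPolynomial (Fin n) ℝ} (hg : g.totalDegree ≤ d) :
    g ∈ fallingSpan n d := by
  rw [g.as_sum]
  refine sum_mem fun s hs => fallingSpan_mono ?_ (monomial_mem_fallingSpan s _)
  exact (MvPolynomial.le_totalDegree hs).trans hg

/-- Newton expansion: evaluation of a polynomial of degree at most `d` at natural points. -/
lemma exists_newton_expansion {n d : ℕ} {g : MvPolynomial (Fin n) ℝ} (hg : g.totalDegree ≤ d) :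
    ∃ c : (Fin n → ℕ) →₀ ℝ, (∀ a, d < ∑ i, a i → c a = 0) ∧
      g = c.sum fun a r => r • fallingPoly a := by
  obtain ⟨c, hc, hs⟩ := (Finsupp.mem_span_image_iff_linearCombination ℝ).1 (mem_fallingSpan hg)
  refine ⟨c, fun a ha => ?_, by rw [← hs]; rfl⟩
  by_contra h
  have := (Finsupp.mem_supported ℝ c).1 hc (Finsupp.mem_support_iff.2 h)
  exact absurd ha (not_lt.2 this)

lemma newton_coeff_eq_zero {n : ℕ} {g : MvPolynomial (Fin n) ℝ} {c : (Fin n → ℕ) →₀ ℝ}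
    (hc : g = c.sum fun a r => r • fallingPoly a) (a b : Fin n → ℕ) (hab : a ≤ b)
    (hb : MvPolynomial.eval (fun i => (b i : ℝ)) g = 0)
    (h : ∀ a' ≤ b, a' ≠ a → c a' = 0) : c a = 0 := by
  rw [hc, Finsupp.sum, map_sum] at hb
  rw [Finset.sum_eq_single a] at hb
  · rw [MvPolynomial.smul_eval, fallingPoly_eval] at hb
    refine (mul_eq_zero.1 hb).resolve_right (Finset.prod_ne_zero_iff.2 fun i _ => ?_)
    exact_mod_cast (Nat.descFactorial_eq_zero_iff_lt.not.2 (not_lt.2 (hab i)))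
  · intro a' _ hne
    rw [MvPolynomial.smul_eval, fallingPoly_eval]
    by_cases hle : a' ≤ b
    · rw [h a' hle hne, zero_mul]
    · obtain ⟨i, hi⟩ : ∃ i, b i < a' i := by simpa [Pi.le_def] using hle
      rw [Finset.prod_eq_zero (Finset.mem_univ i), mul_zero]
      exact_mod_cast Nat.descFactorial_eq_zero_iff_lt.2 hi
  · intro ha
    rw [Finsupp.notMem_support_iff.1 ha, zero_smul, map_zero]

/-- Combinatorial shape of a lattice polytope in the coordinates given by the edges at one of its
vertices: the edges from the vertex `0` have lengths `ℓ i ≥ k`, the edges at `ℓ i • e i` other than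
the one back to `0` point in the directions `e s + m i s • e i`. -/
structure EdgeFrame {n : ℕ} (k : ℕ) (Q : Set (Fin n → ℝ)) (ℓ : Fin n → ℕ)
    (m : Fin n → Fin n → ℤ) : Prop where
  convex : Convex ℝ Q
  zero_mem : (0 : Fin n → ℝ) ∈ Q
  nonneg : ∀ y ∈ Q, ∀ i, 0 ≤ y i
  le_length : ∀ i, k ≤ ℓ i
  diag : ∀ i, m i i = -1
  axis_mem : ∀ i, Pi.single i (ℓ i : ℝ) ∈ Q
  next_mem : ∀ i s, s ≠ i →
    (Pi.single i ((ℓ i : ℝ) + k * m i s) + Pi.single s (k : ℝ) : Fin n → ℝ) ∈ Q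
  facet : ∀ y ∈ Q, ∀ i, 0 ≤ (ℓ i : ℝ) + ∑ s, (m i s : ℝ) * y s

lemma sum_mul_single_add_single {n : ℕ} (c : Fin n → ℝ) (i j : Fin n) (a b : ℝ) :
    ∑ s, c s * (Pi.single i a + Pi.single j b : Fin n → ℝ) s = c i * a + c j * b := by
  simp [mul_add, Finset.sum_add_distrib, Pi.single_apply]

namespace EdgeFrame

variable {n k : ℕ} {Q : Set (Fin n → ℝ)} {ℓ : Fin n → ℕ} {m : Fin n → Fin n → ℤ}

lemma neg_one_le (h : EdgeFrame k Q ℓ m) (hk : 1 ≤ k) {i : Fin n} (hi : ℓ i = k) (s : Fin n) :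
    -1 ≤ m i s := by
  rcases eq_or_ne s i with rfl | hs
  · exact (h.diag s).ge
  have h1 := h.nonneg _ (h.next_mem i s hs) i
  have hk' : (0 : ℝ) < k := by exact_mod_cast hk
  simp [hs.symm, hi] at h1
  have : (-1 : ℝ) ≤ m i s := by nlinarith
  exact_mod_cast this

lemma facet_next (h : EdgeFrame k Q ℓ m) (hk : 1 ≤ k) {i j : Fin n} (hi : ℓ i = k) (hj : ℓ j = k)
    (s : Fin n) (hs : s ≠ j) : 0 ≤ 1 + m i j * (1 + m j s) + m i s := by
  have h1 := h.facet _ (h.next_mem j s hs) i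
  rw [sum_mul_single_add_single, hi, hj] at h1
  have hk' : (0 : ℝ) < k := by exact_mod_cast hk
  have h2 : 0 ≤ (k : ℝ) * (1 + m i j * (1 + m j s) + m i s) := by linarith
  have h3 := nonneg_of_mul_nonneg_right h2 hk'
  exact_mod_cast h3

/-- Two edges from `0` are linked if they span a triangular face with edges of length `k`. -/
def Linked (k : ℕ) (ℓ : Fin n → ℕ) (m : Fin n → Fin n → ℤ) (i j : Fin n) : Prop :=
  ℓ i = k ∧ m i j = -1

lemma Linked.length (h : EdgeFrame k Q ℓ m) {i j : Fin n} (hij : Linked k ℓ m i j) : ℓ j = k := by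
  have h1 := h.facet _ (h.axis_mem j) i
  simp [Pi.single_apply, hij.1, hij.2] at h1
  exact le_antisymm (by exact_mod_cast h1) (h.le_length j)

lemma Linked.symm (h : EdgeFrame k Q ℓ m) (hk : 1 ≤ k) {i j : Fin n} (hij : Linked k ℓ m i j) :
    Linked k ℓ m j i := by
  have hj := hij.length h
  rcases eq_or_ne i j with rfl | hne
  · exact hij
  have h1 := h.facet_next hk hij.1 hj i hne
  rw [hij.2, h.diag] at h1
  exact ⟨hj, le_antisymm (by linarith) (h.neg_one_le hk hj i)⟩

lemma Linked.trans (h : EdgeFrame k Q ℓ m) (hk : 1 ≤ k) {i j l : Fin n}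
    (hij : Linked k ℓ m i j) (hjl : Linked k ℓ m j l) : Linked k ℓ m i l := by
  rcases eq_or_ne l i with rfl | hne
  · exact ⟨hij.1, h.diag _⟩
  have h1 := h.facet_next hk hjl.1 hij.1 l hne
  rw [(hij.symm h hk).2, hjl.2] at h1
  exact ⟨hij.1, le_antisymm (by linarith) (h.neg_one_le hk hij.1 l)⟩

lemma Linked.le (h : EdgeFrame k Q ℓ m) (hk : 1 ≤ k) {i j : Fin n}
    (hij : Linked k ℓ m i j) {s : Fin n} (hs : s ≠ j) : m j s ≤ m i s := by
  have h1 := h.facet_next hk hij.1 (hij.length h) s hs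
  rw [hij.2] at h1
  linarith

lemma single_mem (h : EdgeFrame k Q ℓ m) (i : Fin n) {t : ℝ} (h0 : 0 ≤ t) (ht : t ≤ ℓ i) :
    Pi.single i t ∈ Q := by
  rcases h0.eq_or_lt with rfl | h0
  · simpa using h.zero_mem
  have hl : (0 : ℝ) < ℓ i := h0.trans_le ht
  have h1 := h.convex.smul_mem_of_zero_mem h.zero_mem (h.axis_mem i)
    (t := t / ℓ i) ⟨by positivity, by rw [div_le_one hl]; exact ht⟩
  rwa [← Pi.single_smul, smul_eq_mul, div_mul_cancel₀ _ hl.ne'] at h1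

lemma single_add_single_mem (h : EdgeFrame k Q ℓ m) {i j : Fin n} {s t r : ℝ}
    (hj : Pi.single j t ∈ Q) (hij : (Pi.single i s + Pi.single j t : Fin n → ℝ) ∈ Q)
    (h0 : 0 ≤ r) (hr : r ≤ s) : (Pi.single i r + Pi.single j t : Fin n → ℝ) ∈ Q := by
  rcases h0.eq_or_lt with rfl | h0
  · simpa using hj
  have hs : 0 < s := h0.trans_le hr
  have h1 := h.convex hj hij (a := 1 - r / s) (b := r / s)
    (by rw [sub_nonneg, div_le_one hs]; exact hr) (by positivity) (by ring)
  convert h1 using 1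
  rw [smul_add, ← Pi.single_smul, ← Pi.single_smul i, ← Pi.single_smul, smul_eq_mul, smul_eq_mul,
    smul_eq_mul, div_mul_cancel₀ _ hs.ne', add_left_comm, ← Pi.single_add]
  congr 2
  ring

lemma unit_step_mem (h : EdgeFrame k Q ℓ m) (hk : 1 ≤ k) {i s : Fin n} (hs : s ≠ i) :
    (Pi.single i ((ℓ i : ℝ) + m i s) + Pi.single s 1 : Fin n → ℝ) ∈ Q := by
  have hk' : (1 : ℝ) ≤ k := by exact_mod_cast hk
  have hk0 : (k : ℝ) ≠ 0 := by positivity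
  have h1 := h.convex (h.axis_mem i) (h.next_mem i s hs) (a := 1 - 1 / k) (b := 1 / k)
    (by rw [sub_nonneg, div_le_one (by positivity)]; exact hk') (by positivity) (by ring)
  convert h1 using 1
  rw [smul_add, ← Pi.single_smul, ← Pi.single_smul i, ← Pi.single_smul, smul_eq_mul, smul_eq_mul,
    smul_eq_mul, one_div_mul_cancel hk0, ← add_assoc, ← Pi.single_add]
  congr 2
  field_simp
  ring

lemma one_le_length (h : EdgeFrame k Q ℓ m) (hk : 1 ≤ k) (i : Fin n) : (1 : ℝ) ≤ ℓ i := by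
  exact_mod_cast hk.trans (h.le_length i)

lemma mem_of_le (h : EdgeFrame k Q ℓ m) (hk : 1 ≤ k) {i s : Fin n} (hs : s ≠ i) {r : ℝ}
    (h0 : 0 ≤ r) (hr : r ≤ ℓ i + m i s) :
    (Pi.single i r + Pi.single s 1 : Fin n → ℝ) ∈ Q :=
  h.single_add_single_mem (h.single_mem s zero_le_one (h.one_le_length hk s))
    (h.unit_step_mem hk hs) h0 hr

/-- Convexity in the plane spanned by two coordinate directions. -/
lemma comb_mem (hQ : Convex ℝ Q) {i j : Fin n} {s t s' t' r u : ℝ}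
    (h1 : (Pi.single i s + Pi.single j t : Fin n → ℝ) ∈ Q)
    (h2 : (Pi.single i s' + Pi.single j t' : Fin n → ℝ) ∈ Q)
    (hs : s' ≤ r) (hs' : r ≤ s) (hsum : s + t = r + u) (hsum' : s' + t' = r + u) :
    (Pi.single i r + Pi.single j u : Fin n → ℝ) ∈ Q := by
  rcases (hs.trans hs').eq_or_lt with rfl | hlt
  · obtain rfl : r = s' := le_antisymm hs' hs
    obtain rfl : t = u := by linarith
    exact h1
  have hpos : 0 < s - s' := sub_pos.2 hlt
  have h3 := hQ h1 h2 (a := (r - s') / (s - s')) (b := (s - r) / (s - s'))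
    (div_nonneg (by linarith) hpos.le) (div_nonneg (by linarith) hpos.le)
    (by rw [← add_div, div_eq_one_iff_eq hpos.ne']; ring)
  convert h3 using 1
  simp only [smul_add, ← Pi.single_smul, smul_eq_mul]
  rw [add_add_add_comm, ← Pi.single_add, ← Pi.single_add]
  obtain rfl : t = r + u - s := by linarith
  obtain rfl : t' = r + u - s' := by linarith
  congr 2 <;> field_simp <;> ring

lemma step_mem_of_not_linked_of_length (h : EdgeFrame k Q ℓ m) (hk : 1 ≤ k) {i j : Fin n}
    (hi : ℓ i = k) (hij : ¬ Linked k ℓ m i j) :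
    (Pi.single i (k : ℝ) + Pi.single j 1 : Fin n → ℝ) ∈ Q := by
  have hne : j ≠ i := by rintro rfl; exact hij ⟨hi, h.diag _⟩
  refine h.mem_of_le hk hne (by positivity) ?_
  have h1 := h.neg_one_le hk hi j
  have h2 : m i j ≠ -1 := fun h3 => hij ⟨hi, h3⟩
  have h3 : (0 : ℤ) ≤ m i j := by omega
  have h4 : (0 : ℝ) ≤ m i j := by exact_mod_cast h3
  rw [hi]
  linarith

lemma succ_mem (h : EdgeFrame k Q ℓ m) {i : Fin n} (hi : ℓ i ≠ k) :
    Pi.single i ((k : ℝ) + 1) ∈ Q := by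
  refine h.single_mem i (by positivity) ?_
  have := h.le_length i
  have : k + 1 ≤ ℓ i := by omega
  exact_mod_cast this

lemma step_mem_of_not_linked (h : EdgeFrame k Q ℓ m) (hk : 1 ≤ k) {i j : Fin n}
    (hij : ¬ Linked k ℓ m i j) :
    (Pi.single i (k : ℝ) + Pi.single j 1 : Fin n → ℝ) ∈ Q := by
  by_cases hi : ℓ i = k
  · exact h.step_mem_of_not_linked_of_length hk hi hij
  have hk' : (1 : ℝ) ≤ k := by exact_mod_cast hk
  have h1 : (Pi.single i ((k : ℝ) + 1) + Pi.single j 0 : Fin n → ℝ) ∈ Q := by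
    simpa using h.succ_mem hi
  by_cases hj : ℓ j = k
  · have h2 := h.step_mem_of_not_linked_of_length hk hj (fun h3 => hij (h3.symm h hk))
    rw [add_comm] at h2
    exact comb_mem h.convex h1 h2 hk' (by linarith) (by ring) (by ring)
  · have h2 : (Pi.single i 0 + Pi.single j ((k : ℝ) + 1) : Fin n → ℝ) ∈ Q := by
      simpa using h.succ_mem hj
    exact comb_mem h.convex h1 h2 (by linarith) (by linarith) (by ring) (by ring)

lemma mem_of_not_linked (h : EdgeFrame k Q ℓ m) (hk : 1 ≤ k) {i j : Fin n}
    (hij : ¬ Linked k ℓ m i j) {p q : ℝ} (hp : 1 ≤ p) (hq : 1 ≤ q) (hpq : p + q = k + 1) :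
    (Pi.single i p + Pi.single j q : Fin n → ℝ) ∈ Q := by
  have h1 := h.step_mem_of_not_linked hk hij
  have h2 := h.step_mem_of_not_linked hk (fun h3 => hij (h3.symm h hk))
  rw [add_comm] at h2
  exact comb_mem h.convex h1 h2 hp (by linarith) (by linarith) (by linarith)

lemma add_mem_of_simplex (hQ : Convex ℝ Q) (a : Fin n → ℝ) (ha : ∀ i, 0 ≤ a i) {N : ℝ}
    (hN : 0 < N) (hsum : ∑ i, a i = N) (y : Fin n → ℝ)
    (hy : ∀ i, a i ≠ 0 → Pi.single i N + y ∈ Q) : a + y ∈ Q := by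
  have h1 : ∑ i with a i ≠ 0, (a i / N) • (Pi.single i N + y) ∈ Q := by
    refine hQ.sum_mem (fun i _ => div_nonneg (ha i) hN.le) ?_ (fun i hi => hy i (by simpa using hi))
    rw [← Finset.sum_div, Finset.sum_filter_ne_zero, hsum, div_self hN.ne']
  convert h1 using 1
  rw [Finset.sum_filter_of_ne (p := fun i => a i ≠ 0) fun i _ hi h0 => hi (by simp [h0])]
  simp only [smul_add, Finset.sum_add_distrib, ← Finset.sum_smul, ← Finset.sum_div, hsum,
    div_self hN.ne', one_smul, ← Pi.single_smul, smul_eq_mul, div_mul_cancel₀ _ hN.ne']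
  rw [Finset.univ_sum_single]

lemma linked_of_notMem (h : EdgeFrame k Q ℓ m) (hk : 1 ≤ k) {a : Fin n → ℕ}
    (hsum : ∑ i, a i = k + 1) (haQ : (fun i => (a i : ℝ)) ∉ Q) {i j : Fin n} (hi : a i ≠ 0)
    (hj : a j ≠ 0) : Linked k ℓ m i j := by
  classical
  by_contra hij
  apply haQ
  set C : Finset (Fin n) := {u | u = i ∨ Linked k ℓ m i u} with hC
  have hsplit : ∑ u ∈ C, a u + ∑ u ∈ Cᶜ, a u = k + 1 := by rw [Finset.sum_add_sum_compl, hsum]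
  have hpair : ∀ u ∈ C, ∀ w ∈ Cᶜ, ¬ Linked k ℓ m u w := by
    intro u hu w hw huw
    simp only [hC, Finset.mem_filter, Finset.mem_univ, true_and, Finset.mem_compl, not_or]
      at hu hw
    rcases hu with rfl | hu
    · exact hw.2 huw
    · exact hw.2 (hu.trans h hk huw)
  have hp : 1 ≤ ∑ u ∈ C, a u :=
    (Nat.one_le_iff_ne_zero.2 hi).trans
      (Finset.single_le_sum (f := a) (fun _ _ => Nat.zero_le _) (by simp [hC]))
  rcases Nat.eq_zero_or_pos (∑ u ∈ Cᶜ, a u) with hq | hq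
  · rw [Finset.sum_eq_zero_iff] at hq
    have hjC : j ∈ C := by
      by_contra hjC
      exact hj (hq j (Finset.mem_compl.2 hjC))
    obtain rfl : j = i := by
      simp only [hC, Finset.mem_filter, Finset.mem_univ, true_and] at hjC
      exact hjC.resolve_right hij
    have hlen : ℓ j ≠ k := fun hl => hij ⟨hl, h.diag _⟩
    have hsup : ∀ u, a u ≠ 0 → u = j := by
      intro u hu
      have huC : u ∈ C := by
        by_contra huC
        exact hu (hq u (Finset.mem_compl.2 huC))
      simp only [hC, Finset.mem_filter, Finset.mem_univ, true_and] at huC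
      exact huC.resolve_right fun hl => hlen hl.1
    have := add_mem_of_simplex h.convex (fun i => (a i : ℝ)) (fun i => by positivity)
      (N := (k : ℝ) + 1) (by positivity) (by exact_mod_cast hsum) 0 (fun u hu => by
        rw [hsup u (by exact_mod_cast hu), add_zero]
        exact h.succ_mem hlen)
    rwa [add_zero] at this
  · set p : ℝ := ((∑ u ∈ C, a u : ℕ) : ℝ) with hpdef
    set q : ℝ := ((∑ u ∈ Cᶜ, a u : ℕ) : ℝ) with hqdef
    have hp1 : 1 ≤ p := Nat.one_le_cast.2 hp
    have hq1 : 1 ≤ q := Nat.one_le_cast.2 hq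
    have hpq : p + q = k + 1 := by rw [hpdef, hqdef, ← Nat.cast_add, hsplit, Nat.cast_succ]
    have hp0 : p ≠ 0 := by positivity
    have hq0 : q ≠ 0 := by positivity
    have hpsum : ∑ u ∈ C, (a u : ℝ) / p = 1 := by
      rw [← Finset.sum_div, hpdef, Nat.cast_sum, div_self]
      rw [← Nat.cast_sum]; exact hp0
    have hqsum : ∑ u ∈ Cᶜ, (a u : ℝ) / q = 1 := by
      rw [← Finset.sum_div, hqdef, Nat.cast_sum, div_self]
      rw [← Nat.cast_sum]; exact hq0
    have h1 : ∑ u ∈ C, ((a u : ℝ) / p) • ∑ w ∈ Cᶜ, ((a w : ℝ) / q) •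
        (Pi.single u p + Pi.single w q : Fin n → ℝ) ∈ Q :=
      h.convex.sum_mem (fun u _ => by positivity) hpsum fun u hu =>
        h.convex.sum_mem (fun w _ => by positivity) hqsum fun w hw =>
          h.mem_of_not_linked hk (hpair u hu w hw) hp1 hq1 hpq
    have hinner : ∀ u, ∑ w ∈ Cᶜ, ((a w : ℝ) / q) • (Pi.single u p + Pi.single w q : Fin n → ℝ) =
        Pi.single u p + ∑ w ∈ Cᶜ, Pi.single w (a w : ℝ) := by
      intro u
      simp only [smul_add, Finset.sum_add_distrib, ← Finset.sum_smul, hqsum, one_smul]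
      simp only [← Pi.single_smul, smul_eq_mul, div_mul_cancel₀ _ hq0]
    simp only [hinner] at h1
    simp only [smul_add, Finset.sum_add_distrib, ← Finset.sum_smul, hpsum, one_smul] at h1
    simp only [← Pi.single_smul, smul_eq_mul, div_mul_cancel₀ _ hp0] at h1
    rwa [Finset.sum_add_sum_compl, Finset.univ_sum_single] at h1

lemma exists_facet_coeff (h : EdgeFrame k Q ℓ m) (hk : 1 ≤ k) {g : MvPolynomial (Fin n) ℝ}
    (hg : g ≠ 0) (hdeg : g.totalDegree ≤ k + 1)
    (hvan : ∀ a : Fin n → ℕ, (fun i => (a i : ℝ)) ∈ Q →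
      MvPolynomial.eval (fun i => (a i : ℝ)) g = 0) :
    ∃ i, ℓ i = k ∧ ∀ s, m i s = 0 ∨ m i s = -1 := by
  classical
  by_contra! hcon
  obtain ⟨c, hc, hgc⟩ := exists_newton_expansion hdeg
  have hstep : ∀ i, ℓ i = k → ∃ s, 1 ≤ m i s := by
    intro i hi
    obtain ⟨s, h0, h1⟩ := hcon i hi
    have := h.neg_one_le hk hi s
    exact ⟨s, by omega⟩
  have hsmall : ∀ N ≤ k, ∀ a : Fin n → ℕ, ∑ i, a i = N → c a = 0 := by
    intro N
    induction N using Nat.strong_induction_on with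
    | _ N ih =>
      intro hN a ha
      refine newton_coeff_eq_zero hgc a a le_rfl (hvan a ?_) fun a' hle hne => ?_
      · rcases Nat.eq_zero_or_pos N with rfl | hpos
        · have : (fun i => (a i : ℝ)) = 0 := by
            funext i
            have := (Finset.sum_eq_zero_iff.1 ha) i (Finset.mem_univ i)
            simp [this]
          rw [this]
          exact h.zero_mem
        · have := add_mem_of_simplex h.convex (fun i => (a i : ℝ)) (fun i => by positivity)
            (N := (N : ℝ)) (by exact_mod_cast hpos) (by exact_mod_cast ha) 0 (fun u _ => by
              rw [add_zero]
              exact h.single_mem u (by positivity) (by exact_mod_cast hN.trans (h.le_length u)))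
          rwa [add_zero] at this
      · have hlt : ∑ i, a' i < N := by
          rw [← ha]
          obtain ⟨hle', i, hi⟩ := Pi.lt_def.1 (lt_of_le_of_ne hle hne)
          exact Finset.sum_lt_sum (fun i _ => hle' i) ⟨i, Finset.mem_univ i, hi⟩
        exact ih _ hlt (hlt.le.trans hN) a' rfl
  have hmem : ∀ a : Fin n → ℕ, ∑ i, a i = k + 1 → (fun i => (a i : ℝ)) ∈ Q → c a = 0 := by
    intro a ha haQ
    refine newton_coeff_eq_zero hgc a a le_rfl (hvan a haQ) fun a' hle hne => ?_
    obtain ⟨hle', i, hi⟩ := Pi.lt_def.1 (lt_of_le_of_ne hle hne)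
    have hlt := Finset.sum_lt_sum (fun i _ => hle' i) ⟨i, Finset.mem_univ i, hi⟩
    exact hsmall _ (by omega) a' rfl
  have hall : ∀ a : Fin n → ℕ, ∑ i, a i = k + 1 → c a = 0 := by
    intro a ha
    by_cases haQ : (fun i => (a i : ℝ)) ∈ Q
    · exact hmem a ha haQ
    obtain ⟨i, hi⟩ : ∃ i, a i ≠ 0 := by
      by_contra! h0
      simp [h0] at ha
    have hlink : ∀ u w, a u ≠ 0 → a w ≠ 0 → Linked k ℓ m u w :=
      fun u w hu hw => h.linked_of_notMem hk ha haQ hu hw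
    obtain ⟨j, hj⟩ := hstep i (hlink i i hi hi).1
    have haj : a j = 0 := by
      by_contra haj
      have := (hlink i j hi haj).2
      omega
    have hmj : ∀ u, a u ≠ 0 → 1 ≤ m u j := fun u hu => by
      have hju : j ≠ i := by rintro rfl; exact hi haj
      exact hj.trans ((hlink u i hu hi).le h hk hju)
    refine newton_coeff_eq_zero hgc a (a + Pi.single j 1) le_self_add (hvan _ ?_)
      fun b hle hne => ?_
    · have := add_mem_of_simplex h.convex (fun i => (a i : ℝ)) (fun i => by positivity)
        (N := (k : ℝ) + 1) (by positivity) (by exact_mod_cast ha) (Pi.single j 1) (fun u hu => by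
          have hu : a u ≠ 0 := by exact_mod_cast hu
          have hju : j ≠ u := by rintro rfl; exact hu haj
          refine h.mem_of_le hk hju (by positivity) ?_
          have h1 : (1 : ℝ) ≤ m u j := by exact_mod_cast hmj u hu
          rw [(hlink u u hu hu).1]
          linarith)
      convert this using 1
      funext u
      rcases eq_or_ne u j with rfl | huj <;> simp_all
    · by_contra hcb
      have hsum : ∑ u, b u = k + 1 := by
        refine le_antisymm (not_lt.1 fun hlt => hcb (hc b hlt)) (not_lt.1 fun hlt => hcb ?_)
        exact hsmall _ (Nat.lt_succ_iff.1 hlt) b rfl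
      have hbQ : (fun u => (b u : ℝ)) ∉ Q := fun hbQ => hcb (hmem b hsum hbQ)
      have hle' : ∀ u, u ≠ j → b u ≤ a u := fun u hu => by simpa [hu] using hle u
      have hbj : b j ≠ 0 := by
        intro hbj
        refine hne (funext fun u => ?_)
        have hle'' : ∀ u ∈ Finset.univ, b u ≤ a u := by
          intro u _
          rcases eq_or_ne u j with rfl | hu
          · simp [hbj]
          · exact hle' u hu
        exact (Finset.sum_eq_sum_iff_of_le hle'').1 (hsum.trans ha.symm) u (Finset.mem_univ u)
      have hbj1 : b j ≤ 1 := by simpa [haj] using hle j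
      obtain ⟨u, huj, hu⟩ : ∃ u, u ≠ j ∧ b u ≠ 0 := by
        by_contra! h0
        rw [Finset.sum_eq_single j (fun u _ huj => h0 u huj) (by simp)] at hsum
        omega
      have hau : a u ≠ 0 := fun h0 => hu (Nat.le_zero.1 (h0 ▸ hle' u huj))
      have h1 := (h.linked_of_notMem hk hsum hbQ hu hbj).2
      have h2 := hmj u hau
      omega
  apply hg
  rw [hgc]
  refine Finset.sum_eq_zero fun a _ => ?_
  have : c a = 0 := by
    rcases lt_trichotomy (∑ i, a i) (k + 1) with h1 | h1 | h1
    · exact hsmall _ (Nat.lt_succ_iff.1 h1) a rfl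
    · exact hall a h1
    · exact hc a h1
  simp [this]

end EdgeFrame

section Polytope

variable {E : Type*} [NormedAddCommGroup E] [NormedSpace ℝ E]

lemma exists_irredundant_generators (T : Finset E) :
    ∃ T' ⊆ T, (∀ t ∈ T, t ∈ PointedCone.hull ℝ (T' : Set E)) ∧
      ∀ t ∈ T', t ∉ PointedCone.hull ℝ ((T' : Set E) \ {t}) := by
  classical
  obtain ⟨T', hT', hmin⟩ := Finset.exists_min_image
    (T.powerset.filter fun T' : Finset E => ∀ t ∈ T, t ∈ PointedCone.hull ℝ (T' : Set E)) Finset.card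
    ⟨T, Finset.mem_filter.2 ⟨Finset.mem_powerset_self T, fun t ht => Submodule.subset_span ht⟩⟩
  rw [Finset.mem_filter, Finset.mem_powerset] at hT'
  refine ⟨T', hT'.1, hT'.2, fun t ht hcone => ?_⟩
  have h1 := hmin (T'.erase t) (Finset.mem_filter.2
    ⟨Finset.mem_powerset.2 ((Finset.erase_subset _ _).trans hT'.1), fun s hs => ?_⟩)
  · exact absurd h1 (not_le.2 (Finset.card_erase_lt_of_mem ht))
  · have hle : PointedCone.hull ℝ (T' : Set E) ≤ PointedCone.hull ℝ ((T' : Set E) \ {t}) := by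
      refine Submodule.span_le.2 fun u hu => ?_
      rcases eq_or_ne u t with rfl | hut
      · exact hcone
      · exact Submodule.subset_span ⟨hu, hut⟩
    rw [Finset.coe_erase]
    exact hle (hT'.2 s hs)

lemma convexHull_subset_pointedCone_hull (s : Set E) :
    convexHull ℝ s ⊆ PointedCone.hull ℝ s :=
  convexHull_min Submodule.subset_span (PointedCone.convex _)

/-- A generator of a pointed finitely generated cone not generated by the others spans an exposed
ray. -/
lemma exists_functional_of_irredundant (T : Finset E) (h0 : (0 : E) ∉ convexHull ℝ (T : Set E))
    {t : E} (ht : t ∈ T) (hirr : t ∉ PointedCone.hull ℝ ((T : Set E) \ {t})) :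
    ∃ φ : E →L[ℝ] ℝ, φ t = 0 ∧ ∀ u ∈ T, u ≠ t → 0 < φ u := by
  have hdisj : Disjoint (convexHull ℝ ((T : Set E) \ {t})) (Submodule.span ℝ {t} : Set E) := by
    rw [Set.disjoint_left]
    intro a ha hat
    obtain ⟨r, rfl⟩ := Submodule.mem_span_singleton.1 hat
    rcases le_or_gt r 0 with hr | hr
    · apply h0
      have h1 : (0 : ℝ) < 1 - r := by linarith
      have := convex_convexHull ℝ (T : Set E)
        (convexHull_mono (Set.sdiff_subset) ha) (subset_convexHull ℝ _ ht)
        (a := 1 / (1 - r)) (b := -r / (1 - r)) (by positivity)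
        (div_nonneg (by linarith) h1.le) (by field_simp; ring)
      convert this using 1
      rw [smul_smul, ← add_smul]
      have : 1 / (1 - r) * r + -r / (1 - r) = 0 := by field_simp; ring
      rw [this, zero_smul]
    · apply hirr
      have := (PointedCone.hull ℝ ((T : Set E) \ {t})).smul_mem (inv_nonneg.2 hr.le)
        (convexHull_subset_pointedCone_hull _ ha)
      convert this using 1
      change t = r⁻¹ • r • t
      rw [inv_smul_smul₀ hr.ne']
  have hfin : ((T : Set E) \ {t}).Finite := T.finite_toSet.subset Set.sdiff_subset
  obtain ⟨f, u, w, hu, huw, hw⟩ := geometric_hahn_banach_compact_closed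
    (convex_convexHull ℝ ((T : Set E) \ {t})) (hfin.isCompact_convexHull ℝ)
    (Submodule.span ℝ {t}).convex (Submodule.closed_of_finiteDimensional _) hdisj
  have hft : f t = 0 := by
    by_contra hne
    have := hw (((w - 1) / f t) • t)
      (Submodule.smul_mem _ _ (Submodule.mem_span_singleton_self t))
    rw [map_smul, smul_eq_mul, div_mul_cancel₀ _ hne] at this
    linarith
  have hw0 : w < 0 := by simpa using hw 0 (zero_mem _)
  refine ⟨-f, by simp [hft], fun s hs hne => ?_⟩
  have := hu s (subset_convexHull ℝ _ ⟨hs, hne⟩)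
  simp only [neg_apply]
  linarith

lemma apply_nonneg_of_mem_hull {s : Set E} {x : E} (hx : x ∈ PointedCone.hull ℝ s)
    (φ : E →ₗ[ℝ] ℝ) (h : ∀ u ∈ s, 0 ≤ φ u) : 0 ≤ φ x := by
  induction hx using Submodule.span_induction with
  | mem x hx => exact h x hx
  | zero => simp
  | add x y _ _ hx hy => rw [map_add]; exact add_nonneg hx hy
  | smul r x _ hx =>
    change 0 ≤ φ ((r : ℝ) • x)
    rw [map_smul]
    exact mul_nonneg r.2 hx

lemma eq_smul_of_mem_hull (T : Finset E) {t x : E} (ht : t ∈ T)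
    (hx : x ∈ PointedCone.hull ℝ (T : Set E)) (φ : E →ₗ[ℝ] ℝ) (hφt : φ t = 0)
    (hφ : ∀ u ∈ T, u ≠ t → 0 < φ u) (hφx : φ x = 0) : ∃ θ : ℝ, 0 ≤ θ ∧ x = θ • t := by
  obtain ⟨f, -, rfl⟩ := Submodule.mem_span_finset.1 hx
  have hf : ∀ u ∈ T, u ≠ t → f u = 0 := by
    have hnn : ∀ u ∈ T, 0 ≤ (f u : ℝ) * φ u := fun u hu => by
      rcases eq_or_ne u t with rfl | hne
      · simp [hφt]
      · exact mul_nonneg (f u).2 (hφ u hu hne).le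
    have hs : ∑ u ∈ T, (f u : ℝ) * φ u = 0 := by
      rw [map_sum] at hφx
      refine Eq.trans ?_ hφx
      exact Finset.sum_congr rfl fun u _ => (map_smul φ (f u : ℝ) u).symm
    intro u hu hne
    have := (Finset.sum_eq_zero_iff_of_nonneg hnn).1 hs u hu
    exact Subtype.ext ((mul_eq_zero.1 this).resolve_right (hφ u hu hne).ne')
  refine ⟨f t, (f t).2, ?_⟩
  rw [Finset.sum_eq_single_of_mem t ht fun u hu hne => by rw [hf u hu hne, zero_smul]]
  rfl

lemma sub_mem_hull_of_mem_convexHull (S : Set E) (v : E) {x : E} (hx : x ∈ convexHull ℝ S) :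
    x - v ∈ PointedCone.hull ℝ ((fun s => s - v) '' (S \ {v})) := by
  have hconv : Convex ℝ {x : E | x - v ∈ PointedCone.hull ℝ ((fun s => s - v) '' (S \ {v}))} := by
    have := (PointedCone.convex
      (PointedCone.hull ℝ ((fun s => s - v) '' (S \ {v})))).translate_preimage_left (-v)
    simp only [sub_eq_add_neg] at this ⊢
    exact this
  refine convexHull_min (fun s hs => ?_) hconv hx
  rcases eq_or_ne s v with rfl | hne
  · simp
  · exact Submodule.subset_span ⟨s, ⟨hs, hne⟩, rfl⟩

lemma exists_exposed_segment (S : Finset E) {v : E}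
    (hv : v ∈ Set.extremePoints ℝ (convexHull ℝ (S : Set E))) (T' : Finset E)
    (hT' : ∀ t ∈ T', v + t ∈ S ∧ t ≠ 0)
    (hgen : ∀ x ∈ convexHull ℝ (S : Set E), x - v ∈ PointedCone.hull ℝ (T' : Set E))
    {t : E} (ht : t ∈ T') (hirr : t ∉ PointedCone.hull ℝ ((T' : Set E) \ {t})) :
    ∃ c ∈ S, c ≠ v ∧ IsExposed ℝ (convexHull ℝ (S : Set E)) (segment ℝ v c) ∧
      ∃ r : ℝ, 0 ≤ r ∧ t = r • (c - v) := by
  classical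
  set P := convexHull ℝ (S : Set E) with hP
  obtain ⟨hvP, hdiff⟩ := (convex_convexHull ℝ _).mem_extremePoints_iff_convex_sdiff.1 hv
  have h0 : (0 : E) ∉ convexHull ℝ (T' : Set E) := by
    intro h0
    have hconv := hdiff.translate_preimage_right v
    have hsub : (T' : Set E) ⊆ (fun z => v + z) ⁻¹' (P \ {v}) := fun u hu =>
      ⟨subset_convexHull ℝ _ (hT' u hu).1, by simpa using (hT' u hu).2⟩
    have := convexHull_min hsub hconv h0
    simp at this
  obtain ⟨φ, hφt, hφ⟩ := exists_functional_of_irredundant T' h0 ht hirr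
  have hφ' : ∀ u ∈ (T' : Set E), 0 ≤ φ u := fun u hu => by
    rcases eq_or_ne u t with rfl | hne
    · exact hφt.ge
    · exact (hφ u hu hne).le
  have hmin : ∀ x ∈ P, φ v ≤ φ x := fun x hx => by
    have := apply_nonneg_of_mem_hull (hgen x hx) (φ : E →ₗ[ℝ] ℝ) hφ'
    simpa using this
  set F := S.filter fun s => φ s = φ v with hF
  have hray : ∀ s : E, ∃ θ : ℝ, s ∈ F → 0 ≤ θ ∧ s - v = θ • t := by
    intro s
    by_cases hs : s ∈ F
    · obtain ⟨hsS, hsφ⟩ := Finset.mem_filter.1 hs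
      obtain ⟨θ, h1, h2⟩ := eq_smul_of_mem_hull T' ht (hgen s (subset_convexHull ℝ _ hsS))
        (φ : E →ₗ[ℝ] ℝ) hφt hφ (by simp [hsφ])
      exact ⟨θ, fun _ => ⟨h1, h2⟩⟩
    · exact ⟨0, fun h => absurd h hs⟩
  choose θ hθ using hray
  have ht0 := (hT' t ht).2
  have htF : v + t ∈ F := Finset.mem_filter.2 ⟨(hT' t ht).1, by simp [hφt]⟩
  obtain ⟨c, hcF, hmax⟩ := Finset.exists_max_image F θ ⟨_, htF⟩
  have hθt : θ (v + t) = 1 := by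
    have := (hθ _ htF).2
    rw [add_sub_cancel_left] at this
    by_contra hne
    have h2 : (1 - θ (v + t)) • t = 0 := by rw [sub_smul, one_smul, ← this, sub_self]
    rcases smul_eq_zero.1 h2 with h3 | h3
    · exact hne (by linarith)
    · exact ht0 h3
  have hc1 : 1 ≤ θ c := hθt ▸ hmax _ htF
  have hc0 : 0 < θ c := by linarith
  have hcv := (hθ c hcF).2
  have hseg : ∀ s ∈ F, s ∈ segment ℝ v c := by
    intro s hs
    rw [segment_eq_image']
    refine ⟨θ s / θ c, ⟨div_nonneg (hθ s hs).1 hc0.le, (div_le_one hc0).2 (hmax s hs)⟩, ?_⟩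
    change v + (θ s / θ c) • (c - v) = s
    rw [hcv, smul_smul, div_mul_cancel₀ _ hc0.ne', ← (hθ s hs).2, add_sub_cancel]
  obtain ⟨hcS, hcφ⟩ := Finset.mem_filter.1 hcF
  refine ⟨c, hcS, ?_, fun _ => ⟨-φ, ?_⟩, (θ c)⁻¹, by positivity, ?_⟩
  · rintro rfl
    rw [sub_self] at hcv
    exact (smul_ne_zero hc0.ne' ht0) hcv.symm
  · ext x
    constructor
    · intro hx
      have hφx : φ x = φ v := by
        obtain ⟨a, b, -, -, hab, rfl⟩ := hx
        simp only [map_add, map_smul, smul_eq_mul, hcφ]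
        rw [← add_mul, hab, one_mul]
      refine ⟨(convex_convexHull ℝ _).segment_subset hvP (subset_convexHull ℝ _ hcS) hx,
        fun y hy => ?_⟩
      simpa [hφx] using hmin y hy
    · rintro ⟨hxP, hx⟩
      have hφx : φ x = φ v := le_antisymm (by simpa using hx v hvP) (hmin x hxP)
      obtain ⟨w, hw0, hw1, rfl⟩ := Finset.mem_convexHull'.1 hxP
      have hsum : ∑ s ∈ S, w s * (φ s - φ v) = 0 := by
        simp only [mul_sub, Finset.sum_sub_distrib, ← Finset.sum_mul, hw1, one_mul]
        rw [← hφx, map_sum]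
        simp
      have hzero := (Finset.sum_eq_zero_iff_of_nonneg fun s hs => mul_nonneg (hw0 s hs)
        (sub_nonneg.2 (hmin s (subset_convexHull ℝ _ hs)))).1 hsum
      have hmem : ∑ s ∈ S with w s ≠ 0, w s • s ∈ segment ℝ v c := by
        refine (convex_segment v c).sum_mem
          (fun s hs => hw0 s (Finset.mem_filter.1 hs).1) ?_ fun s hs => ?_
        · rw [Finset.sum_filter_ne_zero, hw1]
        · obtain ⟨hsS, hne⟩ := Finset.mem_filter.1 hs
          refine hseg s (Finset.mem_filter.2 ⟨hsS, ?_⟩)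
          exact sub_eq_zero.1 ((mul_eq_zero.1 (hzero s hsS)).resolve_left hne)
      rwa [Finset.sum_filter_of_ne (p := fun s => w s ≠ 0)
        fun s _ h h0 => h (by simp [h0])] at hmem
  · rw [hcv, smul_smul, inv_mul_cancel₀ hc0.ne', one_smul]

/-- A polytope is contained in the cone spanned by the edges at any of its vertices. -/
lemma sub_mem_hull_edges (S : Finset E) {v : E}
    (hv : v ∈ Set.extremePoints ℝ (convexHull ℝ (S : Set E))) {x : E}
    (hx : x ∈ convexHull ℝ (S : Set E)) :
    x - v ∈ PointedCone.hull ℝ ((fun c => c - v) '' {c | c ∈ S ∧ c ≠ v ∧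
      IsExposed ℝ (convexHull ℝ (S : Set E)) (segment ℝ v c)}) := by
  classical
  obtain ⟨T', hsub, hgen, hirr⟩ := exists_irredundant_generators ((S.erase v).image fun s => s - v)
  have hgen' : ∀ x ∈ convexHull ℝ (S : Set E), x - v ∈ PointedCone.hull ℝ (T' : Set E) := by
    intro x hx
    refine Submodule.span_le.2 ?_ (sub_mem_hull_of_mem_convexHull _ v hx)
    rintro _ ⟨s, ⟨hs, hne⟩, rfl⟩
    exact hgen _ (Finset.mem_image_of_mem _ (Finset.mem_erase.2 ⟨hne, hs⟩))
  have hT' : ∀ t ∈ T', v + t ∈ S ∧ t ≠ 0 := by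
    intro t ht
    obtain ⟨s, hs, rfl⟩ := Finset.mem_image.1 (hsub ht)
    obtain ⟨hne, hs⟩ := Finset.mem_erase.1 hs
    exact ⟨by simpa using hs, sub_ne_zero.2 hne⟩
  refine Submodule.span_le.2 ?_ (hgen' x hx)
  intro t ht
  obtain ⟨c, hc, hne, hexp, r, hr, rfl⟩ := exists_exposed_segment S hv T' hT' hgen' ht (hirr t ht)
  exact Submodule.smul_mem _ (⟨r, hr⟩ : {r : ℝ // 0 ≤ r})
    (Submodule.subset_span ⟨c, ⟨hc, hne, hexp⟩, rfl⟩)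

end Polytope

section Frame

variable {n : ℕ}

lemma toR_injective : Function.Injective (toR : (Fin n → ℤ) → Fin n → ℝ) := fun v w h =>
  funext fun i => by simpa [toR] using congrFun h i

lemma toR_add (v w : Fin n → ℤ) : toR (v + w) = toR v + toR w := by
  funext i; simp [toR]

lemma toR_smul (c : ℤ) (v : Fin n → ℤ) : toR (c • v) = (c : ℝ) • toR v := by
  funext i; simp [toR]

lemma toR_sub (v w : Fin n → ℤ) : toR (v - w) = toR v - toR w := by
  funext i; simp [toR]

lemma toR_vecMul (z : Fin n → ℤ) (d : Matrix (Fin n) (Fin n) ℤ) :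
    toR (Matrix.vecMul z d) = Matrix.vecMul (toR z) (d.map (Int.cast : ℤ → ℝ)) := by
  funext i; simp [toR, Matrix.vecMul, dotProduct]

lemma smul_primVec (v : Fin n → ℤ) : (latticeLength v : ℤ) • primVec v = v := by
  funext i
  have h : (latticeLength v : ℤ) ∣ v i :=
    Int.natCast_dvd.2 (Finset.gcd_dvd (f := fun i => (v i).natAbs) (Finset.mem_univ i))
  exact Int.mul_ediv_cancel' h

lemma isUnit_det_map {d : Matrix (Fin n) (Fin n) ℤ} (hd : IsUnit d.det) :
    IsUnit (d.map (Int.cast : ℤ → ℝ)).det := by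
  have := hd.map (Int.castRingHom ℝ)
  rwa [RingHom.map_det] at this

lemma vecMul_cast_injective {d : Matrix (Fin n) (Fin n) ℤ} (hd : IsUnit d.det) :
    Function.Injective fun y : Fin n → ℝ => Matrix.vecMul y (d.map (Int.cast : ℤ → ℝ)) :=
  Matrix.vecMul_injective_of_isUnit ((Matrix.isUnit_iff_isUnit_det _).2 (isUnit_det_map hd))

lemma exists_vecMul_eq {d : Matrix (Fin n) (Fin n) ℤ} (hd : IsUnit d.det) (p : Fin n → ℤ) :
    ∃ z, Matrix.vecMul z d = p :=
  ⟨Matrix.vecMul p d⁻¹, by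
    rw [Matrix.vecMul_vecMul, Matrix.nonsing_inv_mul _ hd, Matrix.vecMul_one]⟩

/-- The affine coordinates with origin `v` and basis the rows of `d`. -/
def frameMap (v : Fin n → ℤ) (d : Matrix (Fin n) (Fin n) ℤ) (y : Fin n → ℝ) : Fin n → ℝ :=
  toR v + Matrix.vecMul y (d.map (Int.cast : ℤ → ℝ))

lemma frameMap_injective {v : Fin n → ℤ} {d : Matrix (Fin n) (Fin n) ℤ} (hd : IsUnit d.det) :
    Function.Injective (frameMap v d) := fun _ _ h =>
  vecMul_cast_injective hd (add_left_cancel h)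

lemma frameMap_surjective {v : Fin n → ℤ} {d : Matrix (Fin n) (Fin n) ℤ} (hd : IsUnit d.det) :
    Function.Surjective (frameMap v d) := fun x =>
  ⟨Matrix.vecMul (x - toR v) (d.map (Int.cast : ℤ → ℝ))⁻¹, by
    rw [frameMap, Matrix.vecMul_vecMul, Matrix.nonsing_inv_mul _ (isUnit_det_map hd),
      Matrix.vecMul_one, add_sub_cancel]⟩

lemma frameMap_toR (v z : Fin n → ℤ) (d : Matrix (Fin n) (Fin n) ℤ) :
    frameMap v d (toR z) = toR (v + Matrix.vecMul z d) := by
  rw [frameMap, toR_add, toR_vecMul]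

lemma frameMap_single (v : Fin n → ℤ) (d : Matrix (Fin n) (Fin n) ℤ) (i : Fin n) (t : ℝ) :
    frameMap v d (Pi.single i t) = toR v + t • toR (d i) := by
  rw [frameMap, Matrix.single_vecMul]
  rfl

/-- The rows of `d` are the primitive directions of the edges of `P` at the vertex `v`, these edges
have lattice lengths `L i ≥ k`, and `P` lies in the cone they span. -/
structure VertexFrame (P : Set (Fin n → ℝ)) (k : ℕ) (v : Fin n → ℤ)
    (d : Matrix (Fin n) (Fin n) ℤ) (L : Fin n → ℕ) : Prop where
  det : IsUnit d.det
  edge : ∀ i, IsEdge P v (v + (L i : ℤ) • d i)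
  le_length : ∀ i, k ≤ L i
  unique : ∀ c, IsEdge P v c → ∃ i, c = v + (L i : ℤ) • d i
  cone : ∀ x ∈ P, ∃ α : Fin n → ℝ, (∀ i, 0 ≤ α i) ∧ frameMap v d α = x

lemma right_eq_of_segment_eq {E : Type*} [AddCommGroup E] [Module ℝ E] {v b c : E}
    (h : segment ℝ v c = segment ℝ v b) : c = b := by
  have hc : c ∈ segment ℝ v b := h ▸ right_mem_segment ℝ v c
  have hb : b ∈ segment ℝ v c := h ▸ right_mem_segment ℝ v b
  rw [segment_eq_image'] at hc hb
  obtain ⟨θ, ⟨h0, h1⟩, hθ⟩ := hc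
  obtain ⟨η, ⟨h2, h3⟩, hη⟩ := hb
  dsimp only at hθ hη
  have hcv : c - v = θ • (b - v) := by rw [← hθ]; abel
  have hbv : b - v = η • (c - v) := by rw [← hη]; abel
  have h4 : (1 - θ * η) • (c - v) = 0 := by
    rw [sub_smul, one_smul, mul_smul, ← hbv, ← hcv, sub_self]
  rcases smul_eq_zero.1 h4 with h5 | h5
  · have : θ = 1 := by nlinarith
    rw [← hθ, this, one_smul, add_sub_cancel]
  · rw [h5, smul_zero, sub_eq_zero] at hbv
    rw [hbv, sub_eq_zero.1 h5]

lemma exists_vertexFrame {P : Set (Fin n → ℝ)} {k : ℕ} (hP : IsSmoothPolytope P)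
    (hk : EdgesAtLeast P k) {v : Fin n → ℤ} (hv : IsVertex P (toR v)) :
    ∃ d L, VertexFrame P k v d L := by
  classical
  obtain ⟨b, -, hedge, huniq, hdet⟩ := hP.2.2 v hv
  have hb : ∀ i, b i = v + (latticeLength (b i - v) : ℤ) • primVec (b i - v) := fun i => by
    rw [smul_primVec, add_sub_cancel]
  have huniq' : ∀ c, IsEdge P v c → ∃ i, c = b i := fun c hc => by
    obtain ⟨i, hi⟩ := huniq c hc
    exact ⟨i, toR_injective (right_eq_of_segment_eq hi)⟩
  refine ⟨Matrix.of fun i => primVec (b i - v), fun i => latticeLength (b i - v), hdet,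
    fun i => ?_, fun i => hk _ _ (hedge i), fun c hc => ?_, fun x hx => ?_⟩
  · have := hedge i
    rw [hb i] at this
    exact this
  · obtain ⟨i, rfl⟩ := huniq' c hc
    exact ⟨i, hb i⟩
  · obtain ⟨S, hS⟩ := hP.1
    have hS' : P = convexHull ℝ ((S.image toR : Finset (Fin n → ℝ)) : Set (Fin n → ℝ)) := by
      rw [hS, Finset.coe_image]
    have hv' := hv
    rw [IsVertex, hS'] at hv'
    have hx' := hx
    rw [hS'] at hx'
    have hcone := sub_mem_hull_edges (S.image toR) hv' hx'
    rw [← hS'] at hcone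
    suffices h : ∃ α : Fin n → ℝ, (∀ i, 0 ≤ α i) ∧ Matrix.vecMul α
        ((Matrix.of fun i => primVec (b i - v)).map (Int.cast : ℤ → ℝ)) = x - toR v by
      obtain ⟨α, h0, h1⟩ := h
      exact ⟨α, h0, by rw [frameMap, h1, add_sub_cancel]⟩
    generalize x - toR v = y at hcone ⊢
    induction hcone using Submodule.span_induction with
    | mem x hx =>
      obtain ⟨c, ⟨hcS, hne, hexp⟩, rfl⟩ := hx
      obtain ⟨p, -, rfl⟩ := Finset.mem_image.1 hcS
      obtain ⟨i, rfl⟩ := huniq' p ⟨fun h => hne (by rw [h]), hexp⟩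
      refine ⟨Pi.single i (latticeLength (b i - v) : ℝ), fun j => ?_, ?_⟩
      · by_cases hj : j = i
        · subst hj; simp
        · simp [hj]
      · rw [Matrix.single_vecMul]
        change (latticeLength (b i - v) : ℝ) • toR (primVec (b i - v)) = toR (b i) - toR v
        rw [← toR_sub]
        nth_rw 3 [← smul_primVec (b i - v)]
        rw [toR_smul, Int.cast_natCast]
    | zero => exact ⟨0, fun _ => le_rfl, Matrix.zero_vecMul _⟩
    | add x y _ _ hx hy =>
      obtain ⟨α, h0, h1⟩ := hx
      obtain ⟨β, h2, h3⟩ := hy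
      exact ⟨α + β, fun i => add_nonneg (h0 i) (h2 i), by rw [Matrix.add_vecMul, h1, h3]⟩
    | smul r x _ hx =>
      obtain ⟨α, h0, h1⟩ := hx
      exact ⟨(r : ℝ) • α, fun i => mul_nonneg r.2 (h0 i), by rw [Matrix.smul_vecMul, h1]; rfl⟩

lemma right_mem_extremePoints_segment {E : Type*} [AddCommGroup E] [Module ℝ E] (a b : E) :
    b ∈ Set.extremePoints ℝ (segment ℝ a b) := by
  rcases eq_or_ne a b with rfl | hne
  · simp
  rw [mem_extremePoints_iff_left]
  refine ⟨right_mem_segment ℝ a b, ?_⟩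
  intro x hx y hy hb
  rw [segment_eq_image'] at hx hy
  obtain ⟨s, ⟨hs0, hs1⟩, rfl⟩ := hx
  obtain ⟨t, ⟨ht0, ht1⟩, rfl⟩ := hy
  obtain ⟨p, q, hp, hq, hpq, hb⟩ := hb
  have hba : b - a ≠ 0 := sub_ne_zero.2 hne.symm
  have h1 : (p * s + q * t - 1) • (b - a) = 0 := by
    have h2 : b - a = (p * s + q * t) • (b - a) := by
      nth_rw 1 [← hb]
      have h3 : a = (p + q) • a := by rw [hpq, one_smul]
      nth_rw 5 [h3]
      dsimp only
      module
    rw [sub_smul, one_smul, ← h2, sub_self]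
  have h4 := (smul_eq_zero.1 h1).resolve_right hba
  have : s = 1 := by nlinarith
  simp [this]

lemma IsEdge.isVertex_right {P : Set (Fin n → ℝ)} {a b : Fin n → ℤ} (h : IsEdge P a b) :
    IsVertex P (toR b) :=
  h.2.isExtreme.extremePoints_subset_extremePoints (right_mem_extremePoints_segment _ _)

lemma IsEdge.symm {P : Set (Fin n → ℝ)} {a b : Fin n → ℤ} (h : IsEdge P a b) : IsEdge P b a :=
  ⟨h.1.symm, by rw [segment_symm]; exact h.2⟩

end Frame

section Neighbor

variable {n : ℕ}

/-- A unimodular frame at the far end `L i • eᵢ` of an axis edge of a convex set `Q` in the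
nonnegative orthant consists of vectors `eⱼ + m j • eᵢ` and a multiple of `-eᵢ`. -/
lemma exists_neighbor_coeff {k : ℕ} (hk : 1 ≤ k) {Q : Set (Fin n → ℝ)} (hconv : Convex ℝ Q)
    (hzero : 0 ∈ Q) (hnonneg : ∀ y ∈ Q, ∀ i, 0 ≤ y i) {L : Fin n → ℕ} (hL : ∀ j, k ≤ L j)
    (haxis : ∀ j, Pi.single j (L j : ℝ) ∈ Q) {i : Fin n} {E : Matrix (Fin n) (Fin n) ℤ}
    (hE : IsUnit E.det)
    (hstep : ∀ s, Pi.single i (L i : ℝ) + (k : ℝ) • toR (E s) ∈ Q)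
    (hcone : ∀ y ∈ Q, ∃ α : Fin n → ℝ, (∀ s, 0 ≤ α s) ∧
      frameMap (Pi.single i (L i : ℤ)) E α = y)
    {i₀ : Fin n} (hi₀ : ∀ j, j ≠ i → E i₀ j = 0) (hi₀' : E i₀ i ≤ 0) :
    ∃ m : Fin n → ℤ, m i = -1 ∧
      (∀ s, s ≠ i → Pi.single i ((L i : ℝ) + k * m s) + Pi.single s (k : ℝ) ∈ Q) ∧
      ∀ y ∈ Q, 0 ≤ (L i : ℝ) + ∑ s, (m s : ℝ) * y s := by
  classical
  have hk' : (0 : ℝ) < k := by exact_mod_cast hk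
  have hE0 : ∀ s j, j ≠ i → 0 ≤ E s j := fun s j hj => by
    have := hnonneg _ (hstep s) j
    simp only [Pi.add_apply, Pi.single_eq_of_ne hj, Pi.smul_apply, toR, smul_eq_mul,
      zero_add] at this
    exact_mod_cast nonneg_of_mul_nonneg_right this hk'
  have key : ∀ j, j ≠ i → ∃ s, E s j = 1 ∧ ∀ j', j' ≠ i → j' ≠ j → E s j' = 0 := by
    intro j hj
    have hej : toR (Pi.single j 1) ∈ Q := by
      have hLj : (1 : ℝ) ≤ L j := by exact_mod_cast hk.trans (hL j)
      have := hconv.smul_mem_of_zero_mem hzero (haxis j)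
        (t := (L j : ℝ)⁻¹) ⟨by positivity, inv_le_one_of_one_le₀ hLj⟩
      convert this using 1
      funext l
      by_cases hl : l = j
      · subst hl
        simp only [toR, Pi.single_eq_same, Pi.smul_apply, smul_eq_mul]
        rw [inv_mul_cancel₀ (by positivity), Int.cast_one]
      · simp [toR, hl]
    obtain ⟨α, hα, hαe⟩ := hcone _ hej
    obtain ⟨z, hz⟩ := exists_vecMul_eq hE (Pi.single j 1 - Pi.single i (L i : ℤ))
    have hαz : α = toR z := frameMap_injective (v := Pi.single i (L i : ℤ)) hE (by
      rw [hαe, frameMap_toR, hz, add_sub_cancel])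
    have hz0 : ∀ s, 0 ≤ z s := fun s => by
      have := hα s
      rw [hαz, toR] at this
      exact_mod_cast this
    have hsum : ∀ j', j' ≠ i → ∑ s, z s * E s j' = (Pi.single j 1 : Fin n → ℤ) j' :=
      fun j' hj' => by
        have := congrFun hz j'
        simpa [Matrix.vecMul, dotProduct, hj'] using this
    have hterm : ∀ j', j' ≠ i → ∀ s, z s * E s j' ≤ (Pi.single j 1 : Fin n → ℤ) j' :=
      fun j' hj' s => by
        rw [← hsum j' hj']
        exact Finset.single_le_sum (f := fun s => z s * E s j')
          (fun s _ => mul_nonneg (hz0 s) (hE0 s j' hj')) (Finset.mem_univ s)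
    have hne : ∑ s, z s * E s j ≠ 0 := by rw [hsum j hj]; simp
    obtain ⟨s, -, hs⟩ := Finset.exists_ne_zero_of_sum_ne_zero hne
    have hzs : 0 < z s := lt_of_le_of_ne (hz0 s) (left_ne_zero_of_mul hs).symm
    have hEs : 0 < E s j := lt_of_le_of_ne (hE0 s j hj) (right_ne_zero_of_mul hs).symm
    refine ⟨s, ?_, fun j' hj' hjj' => ?_⟩
    · have := hterm j hj s
      rw [Pi.single_eq_same] at this
      nlinarith
    · have := hterm j' hj' s
      rw [Pi.single_eq_of_ne hjj'] at this
      have := hE0 s j' hj'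
      nlinarith
  choose! σ hσ hσ' using key
  let τ : Fin n → Fin n := fun j => if j = i then i₀ else σ j
  have hne : ∀ j, j ≠ i → σ j ≠ i₀ := fun j hj h => by
    have h1 := hσ j hj
    rw [h, hi₀ j hj] at h1
    exact zero_ne_one h1
  have hτ : Function.Injective τ := fun a b hab => by
    simp only [τ] at hab
    split_ifs at hab with h1 h2 h2
    · rw [h1, h2]
    · exact absurd hab.symm (hne b h2)
    · exact absurd hab (hne a h1)
    · by_contra hne'
      have h3 := hσ' a h1 b h2 (Ne.symm hne')
      rw [hab, hσ b h2] at h3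
      exact one_ne_zero h3
  have hτs : Function.Surjective τ := Finite.injective_iff_surjective.1 hτ
  let m : Fin n → ℤ := fun j => if j = i then -1 else E (σ j) i
  have hmi : m i = -1 := if_pos rfl
  have hm : ∀ j, j ≠ i → m j = E (σ j) i := fun j hj => if_neg hj
  have hrow : ∀ s, 0 ≤ ∑ j, m j * E s j := fun s => by
    obtain ⟨j, rfl⟩ := hτs s
    by_cases hj : j = i
    · have h1 : τ j = i₀ := if_pos hj
      rw [h1, Finset.sum_eq_single i (fun b _ hb => by rw [hi₀ b hb, mul_zero])
        (fun h => absurd (Finset.mem_univ i) h), hmi]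
      linarith
    · have h1 : τ j = σ j := if_neg hj
      rw [h1, Fintype.sum_eq_add j i hj (fun x hx => by rw [hσ' j hj x hx.2 hx.1, mul_zero]),
        hσ j hj, hmi, hm j hj]
      linarith
  refine ⟨m, hmi, fun s hs => ?_, fun y hy => ?_⟩
  · convert hstep (σ s) using 1
    funext j
    rw [hm s hs]
    by_cases hj : j = i
    · subst hj
      simp [toR, hs.symm]
    · by_cases hjs : j = s
      · subst hjs
        simp [toR, hj, hσ j hj]
      · simp [toR, hj, hjs, hσ' s hs j hj hjs]
  · obtain ⟨α, hα, rfl⟩ := hcone y hy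
    have h1 : ∑ j, (m j : ℝ) * frameMap (Pi.single i (L i : ℤ)) E α j =
        -(L i : ℝ) + ∑ s, α s * ((∑ j, m j * E s j : ℤ) : ℝ) := by
      simp only [frameMap, Pi.add_apply, mul_add, Finset.sum_add_distrib]
      congr 1
      · rw [Finset.sum_eq_single i (fun b _ hb => by simp [toR, hb])
          (fun h => absurd (Finset.mem_univ i) h), hmi]
        simp [toR]
      · simp only [Matrix.vecMul, dotProduct, Matrix.map_apply, Int.cast_sum, Int.cast_mul,
          Finset.mul_sum]
        rw [Finset.sum_comm]
        exact Finset.sum_congr rfl fun s _ => Finset.sum_congr rfl fun j _ => by ring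
    rw [h1, add_neg_cancel_left]
    exact Finset.sum_nonneg fun s _ => mul_nonneg (hα s) (by exact_mod_cast hrow s)

end Neighbor

section VertexFrame

variable {n k : ℕ} {P : Set (Fin n → ℝ)} {v : Fin n → ℤ} {d : Matrix (Fin n) (Fin n) ℤ}
  {L : Fin n → ℕ}

lemma IsLatticePolytope.convex (hP : IsLatticePolytope P) : Convex ℝ P := by
  obtain ⟨S, rfl⟩ := hP
  exact convex_convexHull ℝ _

lemma frameMap_frameMap (v u : Fin n → ℤ) (d E : Matrix (Fin n) (Fin n) ℤ) (α : Fin n → ℝ) :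
    frameMap v d (frameMap u E α) = frameMap (v + Matrix.vecMul u d) (E * d) α := by
  have h : (E * d).map (Int.cast : ℤ → ℝ) =
      E.map (Int.cast : ℤ → ℝ) * d.map (Int.cast : ℤ → ℝ) :=
    Matrix.map_mul (f := Int.castRingHom ℝ)
  simp only [frameMap, Matrix.add_vecMul, toR_add, toR_vecMul, Matrix.vecMul_vecMul, h, add_assoc]

lemma frameMap_combo (v : Fin n → ℤ) (d : Matrix (Fin n) (Fin n) ℤ) (x y : Fin n → ℝ) {a b : ℝ}
    (hab : a + b = 1) :
    frameMap v d (a • x + b • y) = a • frameMap v d x + b • frameMap v d y := by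
  have h1 : toR v = (a + b) • toR v := by rw [hab, one_smul]
  simp only [frameMap, Matrix.add_vecMul, Matrix.smul_vecMul]
  nth_rw 1 [h1]
  module

lemma convex_frameMap_preimage (hP : Convex ℝ P) : Convex ℝ (frameMap v d ⁻¹' P) := by
  intro x hx y hy a b ha hb hab
  rw [mem_preimage, frameMap_combo v d x y hab]
  exact hP hx hy ha hb hab

lemma VertexFrame.add_smul_mem (h : VertexFrame P k v d L) (hP : Convex ℝ P) (i : Fin n) {t : ℝ}
    (h0 : 0 ≤ t) (ht : t ≤ L i) : toR v + t • toR (d i) ∈ P := by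
  have hend := (h.edge i).2.subset (right_mem_segment ℝ _ _)
  have hstart := (h.edge i).2.subset (left_mem_segment ℝ _ _)
  rw [toR_add, toR_smul, Int.cast_natCast] at hend
  rcases (Nat.cast_nonneg (α := ℝ) (L i)).eq_or_lt with hL | hL
  · have : t = 0 := by linarith
    rwa [this, zero_smul, add_zero]
  · have := hP.add_smul_mem hstart hend (t := t / L i) ⟨by positivity, (div_le_one hL).2 ht⟩
    rwa [smul_smul, div_mul_cancel₀ _ hL.ne'] at this

lemma VertexFrame.nonneg (h : VertexFrame P k v d L) {y : Fin n → ℝ} (hy : frameMap v d y ∈ P)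
    (i : Fin n) : 0 ≤ y i := by
  obtain ⟨α, hα, hαy⟩ := h.cone _ hy
  rw [← frameMap_injective h.det hαy]
  exact hα i

lemma VertexFrame.exists_edgeFrame (h : VertexFrame P k v d L) (hP : IsSmoothPolytope P)
    (hk : EdgesAtLeast P k) (h1k : 1 ≤ k) (hv : IsVertex P (toR v)) :
    ∃ m, EdgeFrame k (frameMap v d ⁻¹' P) L m := by
  have hconv := hP.1.convex
  have hzero : (0 : Fin n → ℝ) ∈ frameMap v d ⁻¹' P := by
    rw [mem_preimage, frameMap, Matrix.zero_vecMul, add_zero]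
    exact hv.1
  have haxis : ∀ j, Pi.single j (L j : ℝ) ∈ frameMap v d ⁻¹' P := fun j => by
    rw [mem_preimage, frameMap_single]
    exact h.add_smul_mem hconv j (Nat.cast_nonneg _) le_rfl
  have hcoeff : ∀ i, ∃ m : Fin n → ℤ, m i = -1 ∧
      (∀ s, s ≠ i → Pi.single i ((L i : ℝ) + k * m s) + Pi.single s (k : ℝ) ∈
        frameMap v d ⁻¹' P) ∧
      ∀ y ∈ frameMap v d ⁻¹' P, 0 ≤ (L i : ℝ) + ∑ s, (m s : ℝ) * y s := by
    intro i
    obtain ⟨d', L', h'⟩ := exists_vertexFrame hP hk (h.edge i).isVertex_right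
    have hEd : d' * d⁻¹ * d = d' := by
      rw [Matrix.mul_assoc, Matrix.nonsing_inv_mul _ h.det, mul_one]
    have hE : IsUnit (d' * d⁻¹).det := by
      rw [Matrix.det_mul]
      exact h'.det.mul (Matrix.isUnit_nonsing_inv_det _ h.det)
    have hcomp : ∀ α, frameMap v d (frameMap (Pi.single i (L i : ℤ)) (d' * d⁻¹) α) =
        frameMap (v + (L i : ℤ) • d i) d' α := fun α => by
      rw [frameMap_frameMap, hEd, Matrix.single_vecMul]
      rfl
    obtain ⟨i₀, hi₀⟩ := h'.unique v (h.edge i).symm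
    have hrow : ∀ j, (L' i₀ : ℤ) * (d' * d⁻¹) i₀ j = -(L i : ℤ) * (1 : Matrix _ _ ℤ) i j := by
      intro j
      have h2 : (L' i₀ : ℤ) • d' i₀ = (-(L i : ℤ)) • d i := by
        rw [neg_smul, eq_neg_iff_add_eq_zero]
        have h3 : v + ((L' i₀ : ℤ) • d' i₀ + (L i : ℤ) • d i) = v + 0 := by
          rw [add_zero]
          nth_rw 2 [hi₀]
          abel
        exact add_left_cancel h3
      have h3 := congrFun (congrArg (fun u => Matrix.vecMul u d⁻¹) h2) j
      simp only [Matrix.smul_vecMul] at h3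
      rw [← Matrix.mul_nonsing_inv _ h.det]
      exact h3
    have hL' : (0 : ℤ) < L' i₀ := by exact_mod_cast h1k.trans (h'.le_length i₀)
    refine exists_neighbor_coeff (i := i) h1k (convex_frameMap_preimage hconv) hzero
      (fun y hy => h.nonneg hy) h.le_length haxis hE (fun s => ?_) (fun y hy => ?_) (i₀ := i₀)
      (fun j hj => ?_) ?_
    · have h2 := h'.add_smul_mem hconv s (Nat.cast_nonneg k) (by exact_mod_cast h'.le_length s)
      rw [← frameMap_single, ← hcomp, frameMap_single] at h2
      rw [mem_preimage]
      convert h2 using 4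
      funext j
      by_cases hj : j = i
      · subst hj; simp [toR]
      · simp [toR, hj]
    · obtain ⟨α, hα, hαy⟩ := h'.cone _ hy
      exact ⟨α, hα, frameMap_injective h.det ((hcomp α).trans hαy)⟩
    · have h2 := hrow j
      rw [Matrix.one_apply_ne hj.symm, mul_zero] at h2
      exact (mul_eq_zero.1 h2).resolve_left hL'.ne'
    · have h2 := hrow i
      rw [Matrix.one_apply_eq, mul_one] at h2
      have : (0 : ℤ) ≤ L i := Nat.cast_nonneg _
      nlinarith
  choose m hdiag hnext hfacet using hcoeff
  exact ⟨m, convex_frameMap_preimage hconv, hzero, fun y hy => h.nonneg hy, h.le_length, hdiag,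
    haxis, hnext, fun y hy i => hfacet i y hy⟩

end VertexFrame

section Polynomial

variable {n : ℕ}

lemma totalDegree_aeval_le {σ τ : Type*} {φ : σ → MvPolynomial τ ℝ}
    (hφ : ∀ i, (φ i).totalDegree ≤ 1) (f : MvPolynomial σ ℝ) :
    (MvPolynomial.aeval φ f).totalDegree ≤ f.totalDegree := by
  rw [MvPolynomial.aeval_def, MvPolynomial.eval₂_eq]
  refine (MvPolynomial.totalDegree_finsetSum _ _).trans (Finset.sup_le fun s hs => ?_)
  refine (MvPolynomial.totalDegree_mul _ _).trans ?_
  rw [MvPolynomial.algebraMap_eq, MvPolynomial.totalDegree_C, zero_add]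
  refine (MvPolynomial.totalDegree_finsetProd _ _).trans
    (le_trans (Finset.sum_le_sum fun i _ => ?_) (MvPolynomial.le_totalDegree hs))
  exact (MvPolynomial.totalDegree_pow _ _).trans (by nlinarith [hφ i])

/-- The polynomial with value `r + ∑ i, c i * x i` at `x`. -/
noncomputable def affinePoly (r : ℝ) (c : Fin n → ℝ) : MvPolynomial (Fin n) ℝ :=
  MvPolynomial.C r + ∑ i, MvPolynomial.C (c i) * MvPolynomial.X i

lemma eval_affinePoly (r : ℝ) (c x : Fin n → ℝ) :
    MvPolynomial.eval x (affinePoly r c) = r + ∑ i, c i * x i := by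
  simp [affinePoly]

lemma totalDegree_affinePoly_le (r : ℝ) (c : Fin n → ℝ) : (affinePoly r c).totalDegree ≤ 1 := by
  refine (MvPolynomial.totalDegree_add _ _).trans (max_le (by simp) ?_)
  refine (MvPolynomial.totalDegree_finsetSum _ _).trans (Finset.sup_le fun i _ => ?_)
  refine (MvPolynomial.totalDegree_mul _ _).trans ?_
  rw [MvPolynomial.totalDegree_C, MvPolynomial.totalDegree_X]

lemma exists_frame_poly (v : Fin n → ℤ) {d : Matrix (Fin n) (Fin n) ℤ} (hd : IsUnit d.det)
    {f : MvPolynomial (Fin n) ℝ} (hf : f ≠ 0) :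
    ∃ g : MvPolynomial (Fin n) ℝ, g ≠ 0 ∧ g.totalDegree ≤ f.totalDegree ∧
      ∀ y, MvPolynomial.eval y g = MvPolynomial.eval (frameMap v d y) f := by
  let φ : Fin n → MvPolynomial (Fin n) ℝ := fun j => affinePoly (v j) fun i => d i j
  have heval : ∀ y, MvPolynomial.eval y (MvPolynomial.aeval φ f) =
      MvPolynomial.eval (frameMap v d y) f := fun y => by
    rw [MvPolynomial.aeval_def, MvPolynomial.algebraMap_eq, MvPolynomial.eval_eval₂,
      MvPolynomial.eval, MvPolynomial.coe_eval₂Hom]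
    congr 1
    · ext; simp
    · funext j
      refine (eval_affinePoly _ _ y).trans ?_
      simp only [frameMap, toR, Pi.add_apply, Matrix.vecMul, dotProduct, Matrix.map_apply, mul_comm]
  refine ⟨MvPolynomial.aeval φ f, fun h => hf (MvPolynomial.funext fun x => ?_),
    totalDegree_aeval_le (fun j => totalDegree_affinePoly_le _ _) f, heval⟩
  obtain ⟨y, rfl⟩ := frameMap_surjective (v := v) hd x
  rw [← heval y, h, map_zero, map_zero]

lemma exists_poly_of_range {k : ℕ} {c : Fin n → ℤ} (hc : c ≠ 0) (b : ℤ) :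
    ∃ f : MvPolynomial (Fin n) ℝ, f ≠ 0 ∧ f.totalDegree ≤ k + 1 ∧
      ∀ p : Fin n → ℤ, 0 ≤ b + ∑ i, c i * p i → b + ∑ i, c i * p i ≤ k →
        MvPolynomial.eval (toR p) f = 0 := by
  refine ⟨∏ j ∈ Finset.range (k + 1), affinePoly ((b : ℝ) - j) (toR c), ?_, ?_, fun p h0 h1 => ?_⟩
  · refine Finset.prod_ne_zero_iff.2 fun j _ h => hc (funext fun i => ?_)
    have h1 := eval_affinePoly ((b : ℝ) - j) (toR c) 0
    have h2 := eval_affinePoly ((b : ℝ) - j) (toR c) (Pi.single i 1)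
    rw [h] at h1 h2
    simp only [map_zero, Pi.zero_apply, mul_zero, Finset.sum_const_zero, add_zero] at h1
    simp only [map_zero, ← h1, Pi.single_apply, mul_ite, mul_one, mul_zero, Finset.sum_ite_eq',
      Finset.mem_univ, if_true, zero_add, toR] at h2
    exact_mod_cast h2.symm
  · refine (MvPolynomial.totalDegree_finsetProd _ _).trans
      ((Finset.sum_le_card_nsmul _ _ 1 fun j _ => totalDegree_affinePoly_le _ _).trans ?_)
    simp
  · rw [MvPolynomial.eval_prod]
    obtain ⟨t, ht⟩ := Int.eq_ofNat_of_zero_le h0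
    refine Finset.prod_eq_zero (i := t) (Finset.mem_range.2 (by omega)) ?_
    rw [eval_affinePoly]
    have : (b : ℝ) + ∑ i, toR c i * toR p i = t := by
      simp only [toR]
      exact_mod_cast ht
    linarith

end Polynomial

section Cayley

variable {n k : ℕ} {P : Set (Fin n → ℝ)}

lemma IsLatticePolytope.exists_toR_eq (hP : IsLatticePolytope P) {x : Fin n → ℝ}
    (hx : IsVertex P x) : ∃ v, toR v = x := by
  obtain ⟨S, rfl⟩ := hP
  obtain ⟨v, -, hv⟩ := extremePoints_convexHull_subset hx
  exact ⟨v, hv⟩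

lemma exists_isVertex (hP : IsLatticePolytope P) (hdim : IsFullDim P) :
    ∃ v : Fin n → ℤ, IsVertex P (toR v) := by
  have hne : P.Nonempty := by
    rw [nonempty_iff_ne_empty]
    rintro rfl
    rw [IsFullDim, AffineSubspace.span_empty] at hdim
    exact AffineSubspace.bot_ne_top ℝ (Fin n → ℝ) (Fin n → ℝ) hdim
  have hcomp : IsCompact P := by
    obtain ⟨S, rfl⟩ := hP
    exact (S.finite_toSet.image toR).isCompact_convexHull (𝕜 := ℝ)
  obtain ⟨x, hx⟩ := hcomp.extremePoints_nonempty hne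
  obtain ⟨v, rfl⟩ := hP.exists_toR_eq hx
  exact ⟨v, hx⟩

lemma toR_dotProduct (μ w : Fin n → ℤ) : toR μ ⬝ᵥ toR w = ((μ ⬝ᵥ w : ℤ) : ℝ) := by
  simp [toR, dotProduct]

lemma dotProduct_frameMap (μ v : Fin n → ℤ) (d : Matrix (Fin n) (Fin n) ℤ) (y : Fin n → ℝ) :
    toR μ ⬝ᵥ frameMap v d y =
      ((μ ⬝ᵥ v : ℤ) : ℝ) + ∑ s, ((Matrix.mulVec d μ s : ℤ) : ℝ) * y s := by
  rw [frameMap, dotProduct_add, toR_dotProduct, dotProduct_comm (toR μ), ← Matrix.dotProduct_mulVec,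
    dotProduct_comm]
  congr 1
  refine Finset.sum_congr rfl fun s _ => ?_
  simp [Matrix.mulVec, dotProduct, toR, mul_comm (y s)]

/-- An integral functional on `P` with values in `[0, k]` that attains `0` takes only the values
`0` and `k` at the vertices of `P`. -/
lemma eq_zero_or_eq_of_isVertex (hP : IsSmoothPolytope P) (hk : EdgesAtLeast P k)
    {μ : Fin n → ℤ} {c : ℤ} (hrange : ∀ x ∈ P, 0 ≤ toR μ ⬝ᵥ x + c ∧ toR μ ⬝ᵥ x + c ≤ k)
    (hzero : ∃ x ∈ P, toR μ ⬝ᵥ x + c = 0) {u : Fin n → ℤ} (hu : IsVertex P (toR u)) :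
    toR μ ⬝ᵥ toR u + c = 0 ∨ toR μ ⬝ᵥ toR u + c = k := by
  refine or_iff_not_imp_left.2 fun hne => le_antisymm (hrange _ hu.1).2 ?_
  have hpos := lt_of_le_of_ne (hrange _ hu.1).1 (Ne.symm hne)
  obtain ⟨d, L, h⟩ := exists_vertexFrame hP hk hu
  obtain ⟨x, hx, hx0⟩ := hzero
  obtain ⟨α, hα, rfl⟩ := h.cone x hx
  obtain ⟨s, hs⟩ : ∃ s, Matrix.mulVec d μ s < 0 := by
    by_contra! hcon
    rw [dotProduct_frameMap] at hx0
    rw [toR_dotProduct] at hpos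
    have : 0 ≤ ∑ s, ((Matrix.mulVec d μ s : ℤ) : ℝ) * α s :=
      Finset.sum_nonneg fun s _ => mul_nonneg (by exact_mod_cast hcon s) (hα s)
    linarith
  have hmem := h.add_smul_mem hP.1.convex s (Nat.cast_nonneg k) (by exact_mod_cast h.le_length s)
  have h1 := (hrange _ hmem).1
  rw [← frameMap_single, dotProduct_frameMap, Finset.sum_eq_single s
    (fun b _ hb => by rw [Pi.single_eq_of_ne hb, mul_zero])
    (fun h => absurd (Finset.mem_univ s) h), Pi.single_eq_same] at h1
  have h2 : ((Matrix.mulVec d μ s : ℤ) : ℝ) ≤ -1 := by exact_mod_cast Int.le_sub_one_of_lt hs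
  have h3 : (0 : ℝ) ≤ k := Nat.cast_nonneg k
  rw [toR_dotProduct]
  nlinarith

lemma exists_unimodular_row {c : Fin n → ℤ} {i : Fin n} (hi : c i = 1) (l : Fin n) :
    ∃ M : Matrix (Fin n) (Fin n) ℤ, IsUnit M.det ∧ M l = c := by
  have hdet : (Matrix.updateRow (1 : Matrix (Fin n) (Fin n) ℤ) i c).det = 1 := by
    rw [← Matrix.cramer_transpose_apply, Matrix.transpose_one, Matrix.cramer_one]
    exact hi
  refine ⟨(Matrix.updateRow 1 i c).submatrix (Equiv.swap i l) id, ?_, ?_⟩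
  · rw [Matrix.det_permute, hdet, mul_one]
    exact Units.isUnit _
  · funext j
    simp

lemma isVertex_of_isVertex_image {b : Fin n → ℤ} {B : Matrix (Fin n) (Fin n) ℤ}
    (hB : IsUnit B.det) {x : Fin n → ℝ} (hx : IsVertex (frameMap b B '' P) (frameMap b B x)) :
    IsVertex P x := by
  obtain ⟨⟨x', hx', hxx'⟩, hext⟩ := mem_extremePoints_iff_left.1 hx
  rw [frameMap_injective hB hxx'] at hx'
  refine mem_extremePoints_iff_left.2 ⟨hx', fun y hy z hz hyz => frameMap_injective hB
    (hext _ (mem_image_of_mem _ hy) _ (mem_image_of_mem _ hz) ?_)⟩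
  obtain ⟨p, q, hp, hq, hpq, rfl⟩ := hyz
  exact ⟨p, q, hp, hq, hpq, (frameMap_combo b B y z hpq).symm⟩

lemma frameMap_transpose (b : Fin n → ℤ) (A : Matrix (Fin n) (Fin n) ℤ) :
    frameMap b A.transpose =
      fun x : Fin n → ℝ => fun i => (∑ j, (A i j : ℝ) * x j) + (b i : ℝ) := by
  funext x i
  simp only [frameMap, toR, Pi.add_apply, Matrix.vecMul, dotProduct, Matrix.map_apply,
    Matrix.transpose_apply]
  rw [add_comm]
  congr 1
  exact Finset.sum_congr rfl fun j _ => mul_comm _ _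

lemma exists_isCayley {l : Fin n} (hP : IsSmoothPolytope P) (hk : EdgesAtLeast P k) (h1k : 1 ≤ k)
    {f : MvPolynomial (Fin n) ℝ} (hf : f ≠ 0) (hdeg : f.totalDegree ≤ k + 1)
    (hvan : ∀ p : Fin n → ℤ, toR p ∈ P → MvPolynomial.eval (toR p) f = 0) :
    ∃ (A : Matrix (Fin n) (Fin n) ℤ) (b : Fin n → ℤ), IsUnit A.det ∧
      IsCayley ((fun x : Fin n → ℝ => fun i => (∑ j, (A i j : ℝ) * x j) + (b i : ℝ)) '' P) k l := by
  obtain ⟨v, hv⟩ := exists_isVertex hP.1 hP.2.1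
  obtain ⟨d, L, h⟩ := exists_vertexFrame hP hk hv
  obtain ⟨m, hm⟩ := h.exists_edgeFrame hP hk h1k hv
  obtain ⟨g, hg, hgdeg, hgeval⟩ := exists_frame_poly v h.det hf
  obtain ⟨i, hLi, hmi⟩ := hm.exists_facet_coeff h1k hg (hgdeg.trans hdeg) fun a ha => by
    have h1 : (fun i => (a i : ℝ)) = toR (fun i => (a i : ℤ)) := by funext i; simp [toR]
    rw [hgeval, h1, frameMap_toR]
    refine hvan _ ?_
    rw [← frameMap_toR, ← h1]
    exact ha
  obtain ⟨M, hM, hMl⟩ := exists_unimodular_row (c := fun s => -m i s) (i := i)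
    (by simp [hm.diag i]) l
  let μ : Fin n → ℤ := Matrix.mulVec d⁻¹ fun s => -m i s
  have hdμ : Matrix.mulVec d μ = fun s => -m i s := by
    rw [Matrix.mulVec_mulVec, Matrix.mul_nonsing_inv _ h.det, Matrix.one_mulVec]
  have hval : ∀ y, toR μ ⬝ᵥ frameMap v d y + ((-(μ ⬝ᵥ v) : ℤ) : ℝ) =
      -∑ s, (m i s : ℝ) * y s := fun y => by
    rw [dotProduct_frameMap, hdμ]
    simp only [Int.cast_neg, neg_mul, Finset.sum_neg_distrib]
    ring
  have hrange : ∀ x ∈ P, 0 ≤ toR μ ⬝ᵥ x + ((-(μ ⬝ᵥ v) : ℤ) : ℝ) ∧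
      toR μ ⬝ᵥ x + ((-(μ ⬝ᵥ v) : ℤ) : ℝ) ≤ k := fun x hx => by
    obtain ⟨y, hy, rfl⟩ := h.cone x hx
    rw [hval]
    constructor
    · rw [← Finset.sum_neg_distrib]
      refine Finset.sum_nonneg fun s _ => ?_
      rcases hmi s with hs | hs <;> simp [hs, hy s]
    · have := hm.facet y hx i
      rw [hLi] at this
      linarith
  have hzero : ∃ x ∈ P, toR μ ⬝ᵥ x + ((-(μ ⬝ᵥ v) : ℤ) : ℝ) = 0 :=
    ⟨toR v, hv.1, by rw [toR_dotProduct]; push_cast; ring⟩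
  have hAl : (M * d⁻¹.transpose) l = μ := by
    rw [Matrix.mul_apply_eq_vecMul, hMl, Matrix.vecMul_transpose]
  have hA : IsUnit (M * d⁻¹.transpose).det := by
    rw [Matrix.det_mul, Matrix.det_transpose]
    exact hM.mul (Matrix.isUnit_nonsing_inv_det _ h.det)
  refine ⟨M * d⁻¹.transpose, Pi.single l (-(μ ⬝ᵥ v)), hA, ?_⟩
  have hlast : ∀ x : Fin n → ℝ, frameMap (Pi.single l (-(μ ⬝ᵥ v)))
      (M * d⁻¹.transpose).transpose x l = toR μ ⬝ᵥ x + ((-(μ ⬝ᵥ v) : ℤ) : ℝ) := fun x => by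
    rw [frameMap_transpose]
    simp only [hAl, Pi.single_eq_same]
    rfl
  rw [← frameMap_transpose]
  refine ⟨?_, fun w hw => ?_⟩
  · rintro _ ⟨x, hx, rfl⟩
    rw [hlast]
    exact hrange x hx
  · obtain ⟨x, -, rfl⟩ := hw.1
    have hx := isVertex_of_isVertex_image (by rwa [Matrix.det_transpose]) hw
    obtain ⟨u, rfl⟩ := hP.1.exists_toR_eq hx
    rw [hlast]
    exact eq_zero_or_eq_of_isVertex hP hk hrange hzero hx

end Cayley

/-- For a full-dimensional smooth lattice polytope `P ⊂ ℝⁿ` and `k ≥ 1`: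
(all edges have lattice length ≥ k and a nonzero polynomial of degree ≤ k+1 vanishes on
`P ∩ ℤⁿ`) ↔ (all edges have lattice length ≥ k and `P` is lattice-isomorphic to a
Cayley polytope `[P₀ * P₁]^k`, i.e. some unimodular affine map sends `P` to a Cayley
polytope of order `k` with altitude in direction `eₙ`). -/
theorem stmt_0 {n k : ℕ} (hn : 0 < n) (hk : 1 ≤ k) (P : Set (Fin n → ℝ))
    (hP : IsSmoothPolytope P) :
    (EdgesAtLeast P k ∧ ∃ f : MvPolynomial (Fin n) ℝ, f ≠ 0 ∧
        f.totalDegree ≤ k + 1 ∧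
        ∀ p : Fin n → ℤ, toR p ∈ P → MvPolynomial.eval (toR p) f = 0) ↔
    (EdgesAtLeast P k ∧ ∃ (A : Matrix (Fin n) (Fin n) ℤ) (b : Fin n → ℤ),
        IsUnit A.det ∧
        IsCayley ((fun x : Fin n → ℝ => fun i => (∑ j, (A i j : ℝ) * x j) + (b i : ℝ)) '' P)
          k ⟨n - 1, by omega⟩) := by
  refine and_congr_right fun hE => ⟨?_, ?_⟩
  · rintro ⟨f, hf, hdeg, hvan⟩
    exact exists_isCayley hP hE hk hf hdeg hvan
  · rintro ⟨A, b, hA, hrange, -⟩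
    have hrow : A ⟨n - 1, by omega⟩ ≠ 0 := fun h =>
      hA.ne_zero (Matrix.det_eq_zero_of_row_eq_zero _ (congrFun h))
    obtain ⟨f, hf, hdeg, hvan⟩ := exists_poly_of_range (k := k) hrow (b ⟨n - 1, by omega⟩)
    refine ⟨f, hf, hdeg, fun p hp => ?_⟩
    obtain ⟨h0, h1⟩ := hrange _ (mem_image_of_mem _ hp)
    simp only [toR] at h0 h1
    rw [add_comm] at h0 h1
    exact hvan p (by exact_mod_cast h0) (by exact_mod_cast h1)
end

section
/- Let k ≥ 1 be an integer and let P ⊂ ℝ^n be a full-dimensional lattice polytope such that every edge of P has lattice length at least k. If for some i ∈ {1, …, n} the polytope satisfies P ⊆ {x : 0 ≤ x_i ≤ k}, then every vertex of P has i-th coordinate equal to 0 or k; that is, P is a Cayley polytope of order k with altitude in direction e_i. -/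
open Set

/-- A point of the convex hull of a finite set `S` at which a linear functional attains its maximum
over `S` lies in the convex hull of the maximizers in `S`. -/
theorem mem_convexHull_filter_of_apply_eq {E : Type*} [AddCommGroup E] [Module ℝ E]
    {S : Finset E} {m : E →ₗ[ℝ] ℝ} {M : ℝ} (hm : ∀ s ∈ S, m s ≤ M) {x : E}
    (hx : x ∈ convexHull ℝ (S : Set E)) (hxM : m x = M) :
    x ∈ convexHull ℝ {s : E | s ∈ S ∧ m s = M} := by
  obtain ⟨w, hw0, hw1, rfl⟩ := Finset.mem_convexHull'.1 hx
  have hsum : ∑ s ∈ S, w s * (M - m s) = 0 := by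
    simp only [map_sum, map_smul, smul_eq_mul] at hxM
    simp only [mul_sub, Finset.sum_sub_distrib, ← Finset.sum_mul, hw1, hxM, one_mul, sub_self]
  have hzero := (Finset.sum_eq_zero_iff_of_nonneg fun s hs =>
    mul_nonneg (hw0 s hs) (sub_nonneg.2 (hm s hs))).1 hsum
  have hsupp : ∀ s ∈ S, w s ≠ 0 → m s = M := fun s hs h =>
    (sub_eq_zero.1 ((mul_eq_zero.1 (hzero s hs)).resolve_left h)).symm
  classical
  rw [← Finset.sum_filter_of_ne (p := fun s => m s = M) fun s hs h =>
    hsupp s hs fun h0 => h (by rw [h0, zero_smul])]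
  refine (convex_convexHull ℝ _).sum_mem (fun s hs => hw0 s (Finset.mem_filter.1 hs).1) ?_
    fun s hs => subset_convexHull ℝ _ (Finset.mem_filter.1 hs)
  rw [Finset.sum_filter_of_ne fun s hs h => hsupp s hs h, hw1]

/-- A functional that is positive on a finite set `A` can be perturbed so as to also be nonzero on
any finite set `U` of nonzero vectors. -/
theorem exists_forall_pos_forall_ne_zero {E : Type*} [NormedAddCommGroup E] [NormedSpace ℝ E]
    (A U : Finset E) (hU : ∀ u ∈ U, u ≠ 0) (hA : ∃ l : StrongDual ℝ E, ∀ a ∈ A, 0 < l a) :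
    ∃ l : StrongDual ℝ E, (∀ a ∈ A, 0 < l a) ∧ ∀ u ∈ U, l u ≠ 0 := by
  classical
  induction U using Finset.induction_on with
  | empty => simpa using hA
  | insert u U _ ih =>
    obtain ⟨l, hlA, hlU⟩ := ih fun u hu => hU u (Finset.mem_insert_of_mem hu)
    by_cases hlu : l u = 0
    · obtain ⟨g, hg⟩ := SeparatingDual.exists_ne_zero (R := ℝ) (hU u (Finset.mem_insert_self _ _))
      have hcont : ∀ x, Filter.Tendsto (fun ε : ℝ => l x + ε * g x) (nhdsWithin 0 {0}ᶜ)
          (nhds (l x)) := fun x => by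
        have : Continuous fun ε : ℝ => l x + ε * g x := by fun_prop
        simpa using (this.tendsto 0).mono_left nhdsWithin_le_nhds
      have h1 : ∀ᶠ ε in nhdsWithin (0 : ℝ) {0}ᶜ, ∀ a ∈ A, 0 < l a + ε * g a :=
        (Filter.eventually_all_finset A).2 fun a ha => (hcont a).eventually_const_lt (hlA a ha)
      have h2 : ∀ᶠ ε in nhdsWithin (0 : ℝ) {0}ᶜ, ∀ u ∈ U, l u + ε * g u ≠ 0 :=
        (Filter.eventually_all_finset U).2 fun u hu => (hcont u).eventually_ne (hlU u hu)
      obtain ⟨ε, ⟨h1, h2⟩, h3⟩ := ((h1.and h2).and eventually_mem_nhdsWithin).exists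
      refine ⟨l + ε • g, fun a ha => by simpa using h1 a ha, fun x hx => ?_⟩
      rcases Finset.mem_insert.1 hx with rfl | hx
      · simpa [hlu] using ⟨h3, hg⟩
      · simpa using h2 x hx
    · refine ⟨l, hlA, fun x hx => ?_⟩
      rcases Finset.mem_insert.1 hx with rfl | hx
      exacts [hlu, hlU x hx]

/-- A vertex of a polytope is strictly separated from the other generators. -/
theorem exists_forall_lt_of_mem_extremePoints {E : Type*} [NormedAddCommGroup E]
    [NormedSpace ℝ E] {S : Finset E} {v : E}
    (hv : v ∈ extremePoints ℝ (convexHull ℝ (S : Set E))) :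
    ∃ l : StrongDual ℝ E, ∀ s ∈ S, s ≠ v → l s < l v := by
  have hconv := ((convex_convexHull ℝ (S : Set E)).mem_extremePoints_iff_convex_sdiff.1 hv).2
  have hnot : v ∉ convexHull ℝ ((S : Set E) \ {v}) := fun h =>
    (convexHull_min (sdiff_le_sdiff_right (subset_convexHull ℝ _)) hconv h).2 rfl
  obtain ⟨l, c, hlc, hcv⟩ := geometric_hahn_banach_closed_point (convex_convexHull ℝ _)
    ((S.finite_toSet.subset sdiff_subset).isClosed_convexHull ℝ) hnot
  exact ⟨l, fun s hs hsv => (hlc s (subset_convexHull ℝ _ ⟨hs, hsv⟩)).trans hcv⟩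

/-- A vertex of a polytope not maximizing a linear functional `f` lies on an edge along which `f`
increases. -/
theorem exists_isExposed_segment_of_lt {E : Type*} [NormedAddCommGroup E] [NormedSpace ℝ E]
    {S : Finset E} {v : E} (hv : v ∈ extremePoints ℝ (convexHull ℝ (S : Set E)))
    (f : StrongDual ℝ E) (hf : ∃ w ∈ S, f v < f w) :
    ∃ b ∈ S, f v < f b ∧ IsExposed ℝ (convexHull ℝ (S : Set E)) (segment ℝ v b) := by
  classical
  have hvS : v ∈ S := extremePoints_convexHull_subset hv
  let d : E × E → E := fun p => (f p.1 - f v) • (v - p.2) - (f p.2 - f v) • (v - p.1)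
  obtain ⟨l, hl, hlU⟩ := exists_forall_pos_forall_ne_zero ((S.erase v).image (v - ·))
    (((S ×ˢ S).image d).erase 0) (fun u hu => Finset.ne_of_mem_erase hu) (by
      obtain ⟨l, hl⟩ := exists_forall_lt_of_mem_extremePoints hv
      refine ⟨l, fun a ha => ?_⟩
      obtain ⟨s, hs, rfl⟩ := Finset.mem_image.1 ha
      obtain ⟨hsv, hs⟩ := Finset.mem_erase.1 hs
      rw [map_sub]
      exact sub_pos.2 (hl s hs hsv))
  have hpos : ∀ s ∈ S, s ≠ v → 0 < l v - l s := fun s hs hsv => by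
    rw [← map_sub]
    exact hl _ (Finset.mem_image_of_mem _ (Finset.mem_erase.2 ⟨hsv, hs⟩))
  have hker : ∀ s ∈ S, ∀ t ∈ S,
      (f s - f v) * (l v - l t) = (f t - f v) * (l v - l s) → d (s, t) = 0 := by
    intro s hs t ht h
    by_contra hd
    refine hlU _ (Finset.mem_erase.2 ⟨hd, Finset.mem_image_of_mem _ (Finset.mk_mem_product hs ht)⟩)
      ?_
    simp only [d, map_sub, map_smul, smul_eq_mul]
    linarith
  obtain ⟨w, hwS, hw⟩ := hf
  have hwv : w ≠ v := by rintro rfl; exact lt_irrefl _ hw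
  obtain ⟨r, hr, hrmax⟩ := (S.erase v).exists_max_image (fun s => (f s - f v) / (l v - l s))
    ⟨w, Finset.mem_erase.2 ⟨hwv, hwS⟩⟩
  obtain ⟨hrv, hrS⟩ := Finset.mem_erase.1 hr
  set ρ := (f r - f v) / (l v - l r) with hρ
  have hρ0 : 0 < ρ := (div_pos (sub_pos.2 hw) (hpos w hwS hwv)).trans_le
    (hrmax w (Finset.mem_erase.2 ⟨hwv, hwS⟩))
  let m : StrongDual ℝ E := f + ρ • l
  have hm : ∀ x, m x = f x + ρ * l x := fun x => by simp [m]
  have hmS : ∀ s ∈ S, m s ≤ m v := by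
    intro s hs
    by_cases hsv : s = v
    · rw [hsv]
    · have := (div_le_iff₀ (hpos s hs hsv)).1 (hrmax s (Finset.mem_erase.2 ⟨hsv, hs⟩))
      rw [hm, hm]
      linarith
  have hmr : m r = m v := by
    have := div_mul_cancel₀ (f r - f v) (hpos r hrS hrv).ne'
    rw [← hρ] at this
    rw [hm, hm]
    linarith
  obtain ⟨b, hb, hbmax⟩ := (S.filter fun s => m s = m v).exists_max_image f
    ⟨r, Finset.mem_filter.2 ⟨hrS, hmr⟩⟩
  obtain ⟨hbS, hmb⟩ := Finset.mem_filter.1 hb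
  have hfeq : ∀ s, m s = m v → f s - f v = ρ * (l v - l s) := fun s hs => by
    rw [hm, hm] at hs
    linarith
  have hfge : ∀ s ∈ S, m s = m v → 0 ≤ f s - f v := by
    intro s hs hms
    by_cases hsv : s = v
    · rw [hsv, sub_self]
    · rw [hfeq s hms]
      exact (mul_pos hρ0 (hpos s hs hsv)).le
  have hfb : f v < f b := by
    refine lt_of_lt_of_le ?_ (hbmax r (Finset.mem_filter.2 ⟨hrS, hmr⟩))
    rw [← sub_pos, hfeq r hmr]
    exact mul_pos hρ0 (hpos r hrS hrv)
  have hmP : ∀ x ∈ convexHull ℝ (S : Set E), m x ≤ m v :=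
    convexHull_min hmS (convex_halfSpace_le m.isLinear (m v))
  have hvP : v ∈ convexHull ℝ (S : Set E) := subset_convexHull ℝ _ hvS
  refine ⟨b, hbS, hfb, fun _ => ⟨m, Subset.antisymm (fun x hx => ?_) fun x hx => ?_⟩⟩
  · refine ⟨(convex_convexHull ℝ _).segment_subset hvP (subset_convexHull ℝ _ hbS) hx,
      fun y hy => (hmP y hy).trans_eq ?_⟩
    obtain ⟨p, q, -, -, hpq, rfl⟩ := hx
    rw [map_add, map_smul, map_smul, hmb, ← add_smul, hpq, one_smul]
  · have hxM : m x = m v := le_antisymm (hmP x hx.1) (hx.2 v hvP)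
    refine convexHull_min ?_ (convex_segment v b)
      (mem_convexHull_filter_of_apply_eq (m := m.toLinearMap) hmS hx.1 hxM)
    rintro t ⟨htS, hmt⟩
    replace hmt : m t = m v := hmt
    have hd : d (b, t) = 0 := hker b hbS t htS (by rw [hfeq b hmb, hfeq t hmt]; ring)
    have hbv : 0 < f b - f v := sub_pos.2 hfb
    have htb : f t - f v ≤ f b - f v :=
      sub_le_sub_right (hbmax t (Finset.mem_filter.2 ⟨htS, hmt⟩)) _
    rw [segment_eq_image']
    refine ⟨(f t - f v) / (f b - f v), ⟨div_nonneg (hfge t htS hmt) hbv.le,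
      (div_le_one hbv).2 htb⟩, ?_⟩
    have hd' : (f b - f v) • (t - v) = (f t - f v) • (b - v) := by
      rw [← neg_sub v t, ← neg_sub v b, smul_neg, smul_neg, sub_eq_zero.1 hd]
    simp only [div_eq_inv_mul, mul_smul, ← hd', inv_smul_smul₀ hbv.ne', add_sub_cancel]

/-- A full-dimensional convex hull is not contained in a hyperplane `xᵢ = c`. -/
theorem exists_apply_ne_of_isFullDim {n : ℕ} {S : Set (Fin n → ℝ)}
    (h : IsFullDim (convexHull ℝ S)) (i : Fin n) (c : ℝ) : ∃ w ∈ S, w i ≠ c := by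
  by_contra! hS
  rw [IsFullDim, affineSpan_convexHull] at h
  have hle : affineSpan ℝ S ≤ (AffineSubspace.mk' (fun _ => c)
      (LinearMap.ker (LinearMap.proj i : (Fin n → ℝ) →ₗ[ℝ] ℝ))) :=
    affineSpan_le.2 fun w hw => by simp [AffineSubspace.mem_mk', hS w hw]
  have := hle (h ▸ AffineSubspace.mem_top ℝ (Fin n → ℝ) (fun _ => c + 1))
  simp [AffineSubspace.mem_mk'] at this

theorem latticeLength_dvd {n : ℕ} (v : Fin n → ℤ) (i : Fin n) : (latticeLength v : ℤ) ∣ v i :=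
  Int.natCast_dvd.2 (Finset.gcd_dvd (Finset.mem_univ i))

/-- If every edge of a full-dimensional lattice polytope `P` has lattice
length at least `k ≥ 1` and `P ⊆ {x : 0 ≤ xᵢ ≤ k}`, then every vertex of `P` has `i`-th
coordinate `0` or `k`, i.e. `P` is a Cayley polytope of order `k` with altitude `eᵢ`. -/
theorem stmt_2 {n k : ℕ} (hk : 1 ≤ k) (P : Set (Fin n → ℝ))
    (hP : IsLatticePolytope P) (hfull : IsFullDim P)
    (hEdge : EdgesAtLeast P k) (i : Fin n)
    (hslab : ∀ x ∈ P, 0 ≤ x i ∧ x i ≤ (k : ℝ)) :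
    (∀ v : Fin n → ℝ, IsVertex P v → v i = 0 ∨ v i = (k : ℝ)) ∧ IsCayley P k i := by
  suffices h : ∀ v : Fin n → ℝ, IsVertex P v → v i = 0 ∨ v i = (k : ℝ) from ⟨h, hslab, h⟩
  classical
  intro v hv
  obtain ⟨S, rfl⟩ := hP
  rw [← Finset.coe_image] at hv hfull hslab hEdge
  obtain ⟨a, haS, rfl⟩ := Finset.mem_image.1 (extremePoints_convexHull_subset hv)
  have hedge : ∃ b : Fin n → ℤ, b i ≠ a i ∧ toR b ∈ S.image toR ∧
      IsExposed ℝ (convexHull ℝ (S.image toR : Set (Fin n → ℝ))) (segment ℝ (toR a) (toR b)) := by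
    let f : StrongDual ℝ (Fin n → ℝ) := ContinuousLinearMap.proj i
    obtain ⟨w, hwS, hw⟩ := exists_apply_ne_of_isFullDim hfull i (toR a i)
    rcases hw.lt_or_gt with hlt | hlt
    · obtain ⟨b, hb, hfb, hexp⟩ := exists_isExposed_segment_of_lt hv (-f)
        ⟨w, hwS, by simpa [f] using hlt⟩
      obtain ⟨b, -, rfl⟩ := Finset.mem_image.1 hb
      exact ⟨b, fun h => by simp [f, toR, h] at hfb, hb, hexp⟩
    · obtain ⟨b, hb, hfb, hexp⟩ := exists_isExposed_segment_of_lt hv f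
        ⟨w, hwS, by simpa [f] using hlt⟩
      obtain ⟨b, -, rfl⟩ := Finset.mem_image.1 hb
      exact ⟨b, fun h => by simp [f, toR, h] at hfb, hb, hexp⟩
  obtain ⟨b, hba, hbS, hexp⟩ := hedge
  have hlen := hEdge a b ⟨fun h => hba (by rw [h]), hexp⟩
  have hdvd := Int.le_of_dvd (abs_pos.2 (sub_ne_zero.2 hba))
    ((dvd_abs _ _).2 (latticeLength_dvd (b - a) i))
  have ha := hslab _ (subset_convexHull ℝ _ (Finset.mem_image_of_mem _ haS))
  have hb := hslab _ (subset_convexHull ℝ _ hbS)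
  simp only [toR] at ha hb ⊢
  norm_cast at ha hb ⊢
  rcases abs_cases (b i - a i) with h | h <;> omega
end

section
/- Let k ≥ 1 be an integer and let P ⊂ ℝ^n be a full-dimensional smooth lattice polytope that is canonically positioned. Suppose i, j, l ∈ {1, …, n} with j ≠ l, i ≠ j and i ≠ l, and suppose F_j := P ∩ {x : x_j = 0} and F_l := P ∩ {x : x_l = 0} are two distinct facets of P, each of which is a Cayley polytope of order k with altitude in direction e_i (i.e., F_j and F_l are contained in {x : 0 ≤ x_i ≤ k} and all their vertices have i-th coordinate 0 or k). Then P ⊆ {x : 0 ≤ x_i ≤ k}. -/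
open Set

/-- The left endpoint of a segment is an extreme point of it. -/
lemma left_mem_extremePoints_segment {E : Type*} [AddCommGroup E] [Module ℝ E] (a b : E) :
    a ∈ extremePoints ℝ (segment ℝ a b) := by
  refine mem_extremePoints_iff_left.2 ⟨left_mem_segment ℝ a b, ?_⟩
  simp only [segment_eq_image']
  rintro - ⟨θ, ⟨hθ, -⟩, rfl⟩ - ⟨φ, ⟨hφ, -⟩, rfl⟩ ⟨α, β, hα, hβ, hαβ, h⟩
  have h0 : (α * θ + β * φ) • (b - a) = 0 := by
    obtain rfl : α = 1 - β := by linarith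
    rw [← sub_eq_zero] at h
    rw [← h]
    module
  rcases smul_eq_zero.1 h0 with h1 | h1
  · have : θ = 0 := by
      have := mul_nonneg hβ.le hφ
      have := mul_nonneg hα.le hθ
      exact (mul_eq_zero.1 (by linarith : α * θ = 0)).resolve_left hα.ne'
    simp [this]
  · simp [h1]

/-- An extreme point of the convex hull of a finite set is strictly separated from the
other points of the set. -/
lemma exists_forall_lt_of_mem_extremePoints_convexHull {E : Type*} [AddCommGroup E] [Module ℝ E]
    [TopologicalSpace E] [IsTopologicalAddGroup E] [ContinuousSMul ℝ E] [LocallyConvexSpace ℝ E]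
    [T2Space E] {T : Set E} (hT : T.Finite) {q : E}
    (hq : q ∈ extremePoints ℝ (convexHull ℝ T)) :
    ∃ g : E →L[ℝ] ℝ, ∀ t ∈ T, t ≠ q → g q < g t := by
  have h1 := ((convex_convexHull ℝ T).mem_extremePoints_iff_mem_sdiff_convexHull_sdiff).1 hq
  have h2 : q ∉ convexHull ℝ (T \ {q}) := fun h =>
    h1.2 (convexHull_mono (sdiff_subset_sdiff_left (subset_convexHull ℝ T)) h)
  have hc : IsClosed (convexHull ℝ (T \ {q})) :=
    ((hT.subset sdiff_subset).isCompact_convexHull ℝ).isClosed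
  obtain ⟨g, s, hs, hg⟩ := geometric_hahn_banach_point_closed (convex_convexHull ℝ _) hc h2
  exact ⟨g, fun t ht htq => hs.trans (hg t (subset_convexHull ℝ _ ⟨ht, htq⟩))⟩

/-- A continuous functional on the convex hull of a finite set that is negative at a point of the
set is negative at some extreme point. -/
lemma exists_mem_extremePoints_convexHull_neg {E : Type*} [AddCommGroup E] [Module ℝ E]
    [TopologicalSpace E] [IsTopologicalAddGroup E] [ContinuousSMul ℝ E] [LocallyConvexSpace ℝ E]
    [T2Space E] {T : Set E} (hT : T.Finite) (f : E →L[ℝ] ℝ) {t : E} (ht : t ∈ T) (hft : f t < 0) :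
    ∃ q ∈ extremePoints ℝ (convexHull ℝ T), f q < 0 := by
  have hcomp : IsCompact (convexHull ℝ T) := hT.isCompact_convexHull ℝ
  have htc := subset_convexHull ℝ T ht
  obtain ⟨y, hy, hmin⟩ := hcomp.exists_isMinOn ⟨t, htc⟩ f.continuous.continuousOn
  have hexp : IsExposed ℝ (convexHull ℝ T)
      {x ∈ convexHull ℝ T | ∀ z ∈ convexHull ℝ T, (-f) z ≤ (-f) x} := fun _ => ⟨-f, rfl⟩
  obtain ⟨q, hq⟩ := (hexp.isCompact hcomp).extremePoints_nonempty
    ⟨y, hy, fun z hz => by simpa using hmin hz⟩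
  refine ⟨q, hexp.isExtreme.extremePoints_subset_extremePoints hq, ?_⟩
  have h := hq.1.2 t htc
  simp only [neg_apply] at h
  linarith

/-- If a functional is minimised over a finite set `S` exactly on points of a segment with
endpoints in `S`, then this segment is an exposed face of the convex hull. -/
lemma isExposed_segment_of_forall {E : Type*} [AddCommGroup E] [Module ℝ E]
    [TopologicalSpace E] [IsTopologicalAddGroup E] {S : Set E} {v w : E}
    (hv : v ∈ S) (hw : w ∈ S) (L : E →L[ℝ] ℝ) (hvw : L w = L v)
    (hL : ∀ s ∈ S, L v ≤ L s ∧ (L s = L v → s ∈ segment ℝ v w)) :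
    IsExposed ℝ (convexHull ℝ S) (segment ℝ v w) := by
  have hconv : Convex ℝ {y | L v ≤ L y ∧ (L y = L v → y ∈ segment ℝ v w)} := by
    rw [convex_iff_forall_pos]
    rintro a ⟨ha1, ha2⟩ b ⟨hb1, hb2⟩ α β hα hβ hαβ
    obtain rfl : α = 1 - β := by linarith
    simp only [mem_ofPred_eq, map_add, map_smul, smul_eq_mul]
    refine ⟨by nlinarith, fun h => ?_⟩
    have ha : L a = L v := by nlinarith
    have hb : L b = L v := by nlinarith
    exact convex_segment v w (ha2 ha) (hb2 hb) hα.le hβ.le hαβ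
  have hsub := convexHull_min hL hconv
  have hseg : segment ℝ v w ⊆ convexHull ℝ S :=
    (convex_convexHull ℝ S).segment_subset (subset_convexHull ℝ S hv) (subset_convexHull ℝ S hw)
  refine fun _ => ⟨-L, Subset.antisymm (fun x hx => ⟨hseg hx, fun y hy => ?_⟩) ?_⟩
  · obtain ⟨α, β, -, -, hαβ, rfl⟩ := hx
    have h1 := (hsub hy).1
    have h2 : L (α • v + β • w) = L v := by
      simp only [map_add, map_smul, smul_eq_mul, hvw, ← add_mul, hαβ, one_mul]
    simp only [neg_apply, h2]
    linarith
  · rintro x ⟨hx, hmax⟩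
    have h1 := hmax v (subset_convexHull ℝ S hv)
    simp only [neg_apply] at h1
    exact (hsub hx).2 (le_antisymm (by linarith) (hsub hx).1)

/-- If a vertex of a polytope does not minimise a functional, the functional decreases along some
edge at this vertex. -/
lemma exists_isExposed_segment_lt {E : Type*} [AddCommGroup E] [Module ℝ E]
    [TopologicalSpace E] [IsTopologicalAddGroup E] [ContinuousSMul ℝ E] [LocallyConvexSpace ℝ E]
    [T2Space E] {S : Set E} (hS : S.Finite) {v : E} (hv : v ∈ extremePoints ℝ (convexHull ℝ S))
    (f : E →L[ℝ] ℝ) {x : E} (hx : x ∈ convexHull ℝ S) (hfx : f x < f v) :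
    ∃ w ∈ S, IsExposed ℝ (convexHull ℝ S) (segment ℝ v w) ∧ f w < f v := by
  have hvS : v ∈ S := extremePoints_convexHull_subset (𝕜 := ℝ) hv
  obtain ⟨s₀, hs₀, hfs₀⟩ : ∃ s ∈ S, f s < f v := by
    by_contra! h
    have : convexHull ℝ S ⊆ {y | f v ≤ f y} :=
      convexHull_min h (convex_halfSpace_ge f.toLinearMap.isLinear _)
    exact (this hx).not_gt hfx
  obtain ⟨g, hg⟩ := exists_forall_lt_of_mem_extremePoints_convexHull hS hv
  set r : E → E := fun s => (g (s - v))⁻¹ • (s - v) with hr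
  have hgpos : ∀ s ∈ S, s ≠ v → 0 < g (s - v) := fun s hs hsv => by
    rw [map_sub]; linarith [hg s hs hsv]
  have hsr : ∀ s ∈ S, s ≠ v → s - v = g (s - v) • r s := fun s hs hsv => by
    rw [hr, smul_inv_smul₀ (hgpos s hs hsv).ne']
  have hTfin : (r '' (S \ {v})).Finite := (hS.subset sdiff_subset).image r
  have hs₀v : s₀ ≠ v := by rintro rfl; exact hfs₀.false
  obtain ⟨q, hq, hfq⟩ := exists_mem_extremePoints_convexHull_neg hTfin f
    (mem_image_of_mem r ⟨hs₀, hs₀v⟩) (by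
      rw [hr, map_smul, smul_eq_mul, map_sub f]
      exact mul_neg_of_pos_of_neg (inv_pos.2 (hgpos s₀ hs₀ hs₀v)) (by linarith))
  obtain ⟨p, hp⟩ := exists_forall_lt_of_mem_extremePoints_convexHull hTfin hq
  obtain ⟨s₁, hs₁, hs₁q⟩ := extremePoints_convexHull_subset hq
  obtain ⟨w, ⟨⟨hwS, hwv⟩, hwq⟩, hwmax⟩ :=
    ((hS.subset sdiff_subset).subset (sep_subset (S \ {v}) fun s => r s = q)).exists_maximalFor
      (fun s => g (s - v)) _ ⟨s₁, hs₁, hs₁q⟩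
  have hwpos := hgpos w hwS hwv
  have hw : w - v = g (w - v) • q := by rw [← hwq]; exact hsr w hwS hwv
  have hpos : ∀ s ∈ S, s ≠ v → p s - p v = g (s - v) * p (r s) := fun s hs hsv => by
    rw [← map_sub, ← smul_eq_mul, ← map_smul, ← hsr s hs hsv]
  refine ⟨w, hwS, isExposed_segment_of_forall hvS hwS (p - p q • g) ?_ ?_, ?_⟩
  · have h1 := hpos w hwS hwv
    rw [hwq, map_sub] at h1
    simp only [sub_apply, smul_apply, smul_eq_mul]
    linarith
  · intro s hs
    by_cases hsv : s = v
    · subst hsv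
      exact ⟨le_rfl, fun _ => left_mem_segment ℝ s w⟩
    have h1 := hpos s hs hsv
    have h0 := hgpos s hs hsv
    simp only [sub_apply, smul_apply, smul_eq_mul]
    by_cases hsq : r s = q
    · rw [hsq, map_sub] at h1
      refine ⟨by linarith, fun _ => ?_⟩
      have hle : g (s - v) ≤ g (w - v) := by
        rcases le_total (g (s - v)) (g (w - v)) with h | h
        · exact h
        · exact hwmax ⟨⟨hs, hsv⟩, hsq⟩ h
      rw [segment_eq_image']
      refine ⟨g (s - v) / g (w - v), ⟨by positivity, (div_le_one hwpos).2 hle⟩, ?_⟩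
      simp only
      rw [hw, smul_smul, ← hw, div_mul_cancel₀ _ hwpos.ne', ← hsq, ← hsr s hs hsv]
      abel
    · have h2 := mul_lt_mul_of_pos_left (hp _ ⟨s, ⟨hs, hsv⟩, rfl⟩ hsq) h0
      rw [← h1, map_sub] at h2
      exact ⟨by linarith, fun h => by linarith⟩
  · have h1 : f (w - v) < 0 := by
      rw [hw, map_smul, smul_eq_mul]
      exact mul_neg_of_pos_of_neg hwpos hfq
    rw [map_sub] at h1
    linarith

/-- The edge directions of a polytope that is smooth at a vertex are linearly independent. -/
lemma linearIndependent_toR_sub {n : ℕ} {P : Set (Fin n → ℝ)} {v : Fin n → ℤ}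
    {b : Fin n → Fin n → ℤ} (hedge : ∀ m, IsEdge P v (b m))
    (hdet : IsUnit (Matrix.det (Matrix.of fun i => primVec (b i - v)))) :
    LinearIndependent ℝ fun m => toR (b m) - toR v := by
  have hR : IsUnit (Matrix.of fun m => toR (primVec (b m - v))) := by
    rw [Matrix.isUnit_iff_isUnit_det]
    have := hdet.map (Int.castRingHom ℝ)
    rw [RingHom.map_det] at this
    exact this
  have hli : LinearIndependent ℝ fun m => toR (primVec (b m - v)) :=
    Matrix.linearIndependent_rows_iff_isUnit.2 hR
  have hlen : ∀ m, latticeLength (b m - v) ≠ 0 := fun m h => by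
    rw [latticeLength, Finset.gcd_eq_zero_iff] at h
    refine (hedge m).1 (funext fun t => ?_)
    have := h t (Finset.mem_univ t)
    simp only [Pi.sub_apply, Int.natAbs_eq_zero] at this
    omega
  have hsmul := hli.units_smul fun m => Units.mk0 (latticeLength (b m - v) : ℝ)
    (Nat.cast_ne_zero.2 (hlen m))
  convert hsmul using 1
  ext m t
  have hdvd : (latticeLength (b m - v) : ℤ) ∣ (b m - v) t :=
    Int.natCast_dvd.2 (Finset.gcd_dvd (Finset.mem_univ t))
  have h := Int.mul_ediv_cancel' hdvd
  simp only [Pi.sub_apply, Pi.smul_apply', toR, Units.smul_mk0, Pi.smul_apply, smul_eq_mul, primVec]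
  rw [Pi.sub_apply] at h
  exact_mod_cast h.symm

/-- A smooth vertex of a lattice polytope has edges whose directions form a basis, and the polytope
lies in the cone spanned by them. -/
lemma exists_basis_edges {n : ℕ} {P : Set (Fin n → ℝ)} (hP : IsLatticePolytope P)
    {v : Fin n → ℤ} (hv : IsVertex P (toR v)) (hs : SmoothAtVertex P v) :
    ∃ u : Module.Basis (Fin n) ℝ (Fin n → ℝ), (∀ m, toR v + u m ∈ P) ∧
      ∀ x ∈ P, ∀ m, 0 ≤ u.repr (x - toR v) m := by
  obtain ⟨b, -, hedge, hall, hdet⟩ := hs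
  have hli := linearIndependent_toR_sub hedge hdet
  classical
  let u := basisOfPiSpaceOfLinearIndependent hli
  have hu : ∀ m, u m = toR (b m) - toR v := fun m => by
    simp [u]
  refine ⟨u, fun m => ?_, fun x hx m => ?_⟩
  · rw [hu, add_sub_cancel]
    exact (hedge m).2.subset (right_mem_segment ℝ _ _)
  · by_contra! hneg
    obtain ⟨S, rfl⟩ := hP
    obtain ⟨-, ⟨w, hwS, rfl⟩, hexp, hlt⟩ := exists_isExposed_segment_lt
      (S.finite_toSet.image toR) hv (LinearMap.toContinuousLinearMap (u.coord m)) hx (by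
        rw [map_sub, Finsupp.sub_apply] at hneg
        simp only [LinearMap.coe_toContinuousLinearMap', Module.Basis.coord_apply]
        linarith)
    have hvw : v ≠ w := by rintro rfl; exact hlt.false
    obtain ⟨m', hm'⟩ := hall w ⟨hvw, hexp⟩
    have hw : toR w ∈ segment ℝ (toR v) (toR (b m')) := hm' ▸ right_mem_segment ℝ _ _
    rw [segment_eq_image'] at hw
    obtain ⟨θ, ⟨hθ, -⟩, hw⟩ := hw
    simp only [← hu] at hw
    rw [← hw] at hlt
    simp only [LinearMap.coe_toContinuousLinearMap', map_add, map_smul, Module.Basis.coord_apply,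
      Module.Basis.repr_self, smul_eq_mul, Finsupp.single_apply] at hlt
    split_ifs at hlt <;> linarith

/-- A facet through a vertex `v` contains all edges at `v` but at most one. -/
lemma IsFacet.add_mem_or_add_mem {n : ℕ} {P F : Set (Fin n → ℝ)} (hF : IsFacet P F)
    {v : Fin n → ℝ} (hv : v ∈ F) (u : Module.Basis (Fin n) ℝ (Fin n → ℝ))
    (huP : ∀ m, v + u m ∈ P) (hcone : ∀ x ∈ P, ∀ m, 0 ≤ u.repr (x - v) m)
    {m₀ m₁ : Fin n} (hm : m₀ ≠ m₁) : v + u m₀ ∈ F ∨ v + u m₁ ∈ F := by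
  by_contra! hnot
  obtain ⟨f, hf⟩ := hF.1 ⟨v, hv⟩
  have hvmax : ∀ y ∈ P, f y ≤ f v := by rw [hf] at hv; exact hv.2
  have hle : ∀ m, f (u m) ≤ 0 := fun m => by
    have := hvmax _ (huP m)
    rw [map_add] at this
    linarith
  have hne : ∀ m, v + u m ∉ F → f (u m) ≠ 0 := fun m hm h0 => hm <| by
    rw [hf]
    exact ⟨huP m, fun y hy => by rw [map_add, h0, add_zero]; exact hvmax y hy⟩
  have hzero : ∀ m, v + u m ∉ F → ∀ x ∈ F, u.repr (x - v) m = 0 := fun m hm x hx => by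
    have hxP : x ∈ P := hF.1.subset hx
    have hfx : f (x - v) = 0 := by
      rw [hf] at hx
      rw [map_sub, sub_eq_zero]
      exact le_antisymm (hvmax x hxP) (hx.2 v (hF.1.subset hv))
    rw [← u.sum_repr (x - v), map_sum] at hfx
    have := (Finset.sum_eq_zero_iff_of_nonpos fun m' _ => by
      rw [map_smul, smul_eq_mul]
      exact mul_nonpos_of_nonneg_of_nonpos (hcone x hxP m') (hle m')).1 hfx m (Finset.mem_univ m)
    rw [map_smul, smul_eq_mul] at this
    exact (mul_eq_zero.1 this).resolve_right (hne m hm)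
  have hdir : (affineSpan ℝ F).direction ≤
      Submodule.span ℝ (((Finset.univ \ {m₀, m₁}).image u : Finset (Fin n → ℝ)) :
        Set (Fin n → ℝ)) := by
    rw [direction_affineSpan, vectorSpan_eq_span_vsub_set_right ℝ hv, Submodule.span_le]
    rintro - ⟨x, hx, rfl⟩
    rw [Finset.coe_image]
    refine (u.mem_span_image).2 fun m hmem => ?_
    rw [Finset.mem_coe, Finsupp.mem_support_iff] at hmem
    simp only [Finset.coe_sdiff, Finset.coe_univ, mem_sdiff, mem_univ, true_and, Finset.mem_coe,
      Finset.mem_insert, Finset.mem_singleton, not_or]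
    exact ⟨fun h => hmem (h ▸ hzero m₀ hnot.1 x hx), fun h => hmem (h ▸ hzero m₁ hnot.2 x hx)⟩
  have h1 := (Submodule.finrank_mono hdir).trans
    ((finrank_span_finset_le_card _).trans Finset.card_image_le)
  rw [hF.2, Finset.card_sdiff_of_subset (Finset.subset_univ _), Finset.card_pair hm,
    Finset.card_univ, Fintype.card_fin] at h1
  have := m₀.isLt
  have := m₁.isLt
  have : (m₀ : ℕ) ≠ m₁ := fun h => hm (Fin.ext h)
  omega

/-- At a smooth vertex in two coordinate facets, every edge lies in one of these facets; hence
`P` lies in the cone at the vertex spanned by points of these facets. -/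
lemma exists_basis_mem_facets {n : ℕ} {P : Set (Fin n → ℝ)} (hP : IsSmoothPolytope P)
    {j l : Fin n} (hjl : j ≠ l)
    (hFj : IsFacet P (P ∩ {x | x j = 0})) (hFl : IsFacet P (P ∩ {x | x l = 0}))
    {v : Fin n → ℤ} (hv : IsVertex P (toR v)) (hvj : toR v j = 0) (hvl : toR v l = 0) :
    ∃ u : Module.Basis (Fin n) ℝ (Fin n → ℝ),
      (∀ m, toR v + u m ∈ P ∩ {x | x j = 0} ∨ toR v + u m ∈ P ∩ {x | x l = 0}) ∧
      ∀ x ∈ P, ∀ m, 0 ≤ u.repr (x - toR v) m := by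
  obtain ⟨u, huP, hcone⟩ := exists_basis_edges hP.1 hv (hP.2.2 v hv)
  refine ⟨u, fun m => ?_, hcone⟩
  by_contra! hnot
  have hj : ∀ m', m' ≠ m → u m' j = 0 := fun m' hm' => by
    have := ((hFj.add_mem_or_add_mem ⟨hv.1, hvj⟩ u huP hcone hm').resolve_right hnot.1).2
    simpa [hvj] using this
  have hl : ∀ m', m' ≠ m → u m' l = 0 := fun m' hm' => by
    have := ((hFl.add_mem_or_add_mem ⟨hv.1, hvl⟩ u huP hcone hm').resolve_right hnot.2).2
    simpa [hvl] using this
  have hzero : u m l • LinearMap.proj (R := ℝ) (φ := fun _ : Fin n => ℝ) j -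
      u m j • LinearMap.proj (R := ℝ) (φ := fun _ : Fin n => ℝ) l = 0 := by
    refine u.ext fun m' => ?_
    by_cases h : m' = m
    · subst h; simp [mul_comm]
    · simp [hj m' h, hl m' h]
  have hmj : u m j = 0 := by
    simpa [hjl] using LinearMap.congr_fun hzero (Pi.single l 1)
  exact hnot.1 ⟨huP m, by simp [hvj, hmj]⟩

/-- A functional that is nonnegative on a basis is nonnegative on the cone spanned by it. -/
lemma nonneg_of_repr_nonneg {n : ℕ} (u : Module.Basis (Fin n) ℝ (Fin n → ℝ))
    (f : (Fin n → ℝ) →ₗ[ℝ] ℝ) {y : Fin n → ℝ} (hy : ∀ m, 0 ≤ u.repr y m)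
    (hf : ∀ m, 0 ≤ f (u m)) : 0 ≤ f y := by
  rw [← u.sum_repr y, map_sum]
  exact Finset.sum_nonneg fun m _ => by
    rw [map_smul, smul_eq_mul]
    exact mul_nonneg (hy m) (hf m)

/-- (Lemma 3.3 of the paper.) Let `P` be a full-dimensional smooth lattice
polytope, canonically positioned, and let `Fⱼ = P ∩ {xⱼ = 0}` and `Fₗ = P ∩ {xₗ = 0}`
be two distinct facets of `P`, each a Cayley polytope of order `k` with altitude in the
direction `eᵢ` (`i ≠ j`, `i ≠ l`, `j ≠ l`). Then `P ⊆ {x : 0 ≤ xᵢ ≤ k}`. -/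
theorem stmt_3 {n k : ℕ} (hk : 1 ≤ k) (P : Set (Fin n → ℝ))
    (hP : IsSmoothPolytope P) (hpos : CanonicallyPositioned P)
    (i j l : Fin n) (hjl : j ≠ l) (hij : i ≠ j) (hil : i ≠ l)
    (hFj : IsFacet P (P ∩ {x | x j = 0})) (hFl : IsFacet P (P ∩ {x | x l = 0}))
    (hne : P ∩ {x | x j = 0} ≠ P ∩ {x | x l = 0})
    (hCj : IsCayley (P ∩ {x | x j = 0}) k i)
    (hCl : IsCayley (P ∩ {x | x l = 0}) k i) :
    ∀ x ∈ P, 0 ≤ x i ∧ x i ≤ (k : ℝ) := by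
  have key : ∀ a : Fin n → ℤ, IsVertex P (toR a) → toR a j = 0 → toR a l = 0 →
      (toR a i = 0 → ∀ x ∈ P, 0 ≤ x i) ∧ (toR a i = (k : ℝ) → ∀ x ∈ P, x i ≤ (k : ℝ)) := by
    intro a ha haj hal
    obtain ⟨u, hu, hcone⟩ := exists_basis_mem_facets hP hjl hFj hFl ha haj hal
    have hbd : ∀ m, 0 ≤ toR a i + u m i ∧ toR a i + u m i ≤ (k : ℝ) := fun m =>
      (hu m).elim (hCj.1 _) (hCl.1 _)
    refine ⟨fun h0 x hx => ?_, fun h1 x hx => ?_⟩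
    · have := nonneg_of_repr_nonneg u (LinearMap.proj i) (hcone x hx) fun m => by
        simpa [h0] using (hbd m).1
      simpa [h0] using this
    · have := nonneg_of_repr_nonneg u (-LinearMap.proj i) (hcone x hx) fun m => by
        simpa [h1] using (hbd m).2
      simpa [h1] using this
  obtain ⟨a, b, ⟨hab, hexp⟩, haxis⟩ := hpos.2 i
  have ha := haxis (left_mem_segment ℝ _ _)
  have hb := haxis (right_mem_segment ℝ _ _)
  have hext := hexp.isExtreme.extremePoints_subset_extremePoints
  have hva : IsVertex P (toR a) := hext (left_mem_extremePoints_segment _ _)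
  have hvb : IsVertex P (toR b) := hext (by rw [segment_symm]; exact left_mem_extremePoints_segment _ _)
  have hval : ∀ c : Fin n → ℤ, IsVertex P (toR c) → toR c j = 0 →
      toR c i = 0 ∨ toR c i = (k : ℝ) := fun c hc hcj =>
    hCj.2 _ (inter_extremePoints_subset_extremePoints_of_subset inter_subset_left
      ⟨⟨hc.1, hcj⟩, hc⟩)
  have hdiff : toR a i ≠ toR b i := fun h => hab <| funext fun t => by
    have ht : toR a t = toR b t := by
      by_cases hti : t = i
      · rw [hti, h]
      · rw [ha.2 t hti, hb.2 t hti]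
    exact Int.cast_injective (α := ℝ) ht
  have ka := key a hva (ha.2 j hij.symm) (ha.2 l hil.symm)
  have kb := key b hvb (hb.2 j hij.symm) (hb.2 l hil.symm)
  rcases hval a hva (ha.2 j hij.symm) with h1 | h1 <;>
    rcases hval b hvb (hb.2 j hij.symm) with h2 | h2
  · exact absurd (h1.trans h2.symm) hdiff
  · exact fun x hx => ⟨ka.1 h1 x hx, kb.2 h2 x hx⟩
  · exact fun x hx => ⟨kb.1 h2 x hx, ka.2 h1 x hx⟩
  · exact absurd (h1.trans h2.symm) hdiff
end
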